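/- Linear growth estimate for the Riesz potential at the distinguished pair of exponents: Let 0 < α < n, and let p₀, q₀ be determined by the equations 1/q₀ = 1/p₀ − α/n and q₀/p₀′ = 1 − α/n (explicitly, p₀ = (2−α/n)/(α/n − (α/n)² + 1) and q₀ = (2−α/n)/(1−α/n)). Then there is a constant c = c(n,α) such that for every weight w ∈ A_{p₀,q₀} and every measurable f, ‖w·I_α f‖_{L^{q₀}(ℝⁿ)} ≤ c [w]_{A_{p₀,q₀}} ‖w·f‖_{L^{p₀}(ℝⁿ)}. -/

import Mathlib

open MeasureTheory ENNReal Set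

noncomputable section

/-- Euclidean space `ℝⁿ`. -/
abbrev Euc (n : ℕ) := EuclideanSpace ℝ (Fin n)

variable {n : ℕ}

/-- The axis-parallel closed cube with lower corner `a` and side length `h`. -/
def Cube (a : Euc n) (h : ℝ) : Set (Euc n) :=
  {x | ∀ i, a i ≤ x i ∧ x i ≤ a i + h}

/-- The weighted measure `u(E) = ∫_E u dx` of a set. -/
def wMeas (u : Euc n → ℝ) (E : Set (Euc n)) : ℝ≥0∞ :=
  ∫⁻ x in E, ENNReal.ofReal (u x)

/-- The dual exponent `p' = p/(p-1)`. -/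
def dualExp (p : ℝ) : ℝ := p / (p - 1)

/-- The `A_{p,q}` constant of a weight `w` (with the `A_{1,q}` convention when `p = 1`). -/
def Apq (p q : ℝ) (w : Euc n → ℝ) : ℝ≥0∞ :=
  ⨆ (a : Euc n) (h : ℝ) (_ : 0 < h),
    ((volume (Cube a h))⁻¹ * ∫⁻ x in Cube a h, ENNReal.ofReal (w x) ^ q) *
      (if p = 1 then
        (essSup (fun x => (ENNReal.ofReal (w x))⁻¹) (volume.restrict (Cube a h))) ^ q
      else
        ((volume (Cube a h))⁻¹ * ∫⁻ x in Cube a h,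
            ENNReal.ofReal (w x) ^ (-(dualExp p))) ^ (q / dualExp p))

/-- The weighted Lebesgue norm `‖w f‖_{L^p(ℝⁿ)}`. -/
def wLp (w f : Euc n → ℝ) (p : ℝ) : ℝ≥0∞ :=
  (∫⁻ x, (ENNReal.ofReal (w x) * ENNReal.ofReal |f x|) ^ p) ^ (1 / p)

/-- The weighted Lebesgue norm `‖w g‖_{L^q(ℝⁿ)}` of an `ℝ≥0∞`-valued function. -/
def wLpE (w : Euc n → ℝ) (g : Euc n → ℝ≥0∞) (q : ℝ) : ℝ≥0∞ :=
  (∫⁻ x, (ENNReal.ofReal (w x) * g x) ^ q) ^ (1 / q)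

/-- The weak norm `‖g‖_{L^{q,∞}(u)} = sup_{λ>0} λ u({|g|>λ})^{1/q}`. -/
def weakLp (u : Euc n → ℝ) (g : Euc n → ℝ) (q : ℝ) : ℝ≥0∞ :=
  ⨆ (t : ℝ) (_ : 0 < t), ENNReal.ofReal t * wMeas u {x | t < |g x|} ^ (1 / q)

/-- The weak norm of an `ℝ≥0∞`-valued function. -/
def weakLpE (u : Euc n → ℝ) (g : Euc n → ℝ≥0∞) (q : ℝ) : ℝ≥0∞ :=
  ⨆ (t : ℝ) (_ : 0 < t), ENNReal.ofReal t * wMeas u {x | ENNReal.ofReal t < g x} ^ (1 / q)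

/-- The fractional integral (Riesz potential) `I_α f(x) = ∫ |f(y)| |x-y|^{α-n} dy`. -/
def riesz (α : ℝ) (f : Euc n → ℝ) (x : Euc n) : ℝ≥0∞ :=
  ∫⁻ y, ENNReal.ofReal |f y| * ENNReal.ofReal (‖x - y‖ ^ (α - (n : ℝ)))

/-- The fractional maximal operator `M_α f(x) = sup_{Q ∋ x} |Q|^{α/n-1} ∫_Q |f|`. -/
def fracMax (α : ℝ) (f : Euc n → ℝ) (x : Euc n) : ℝ≥0∞ :=
  ⨆ (a : Euc n) (h : ℝ) (_ : 0 < h) (_ : x ∈ Cube a h),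
    volume (Cube a h) ^ (α / (n : ℝ) - 1) * ∫⁻ y in Cube a h, ENNReal.ofReal |f y|

set_option linter.unusedSectionVars false

section Abstract

variable {X : Type*} [MeasurableSpace X] {ι : Type*} [Countable ι] [MeasurableSpace ι]
  [DiscreteMeasurableSpace ι]

/-- The dyadic cube of level `k` containing `x`. -/
def dq (π : ℤ → X → ι) (k : ℤ) (x : X) : Set X := π k ⁻¹' {π k x}

/-- Averages over dyadic cubes. -/
def dE (π : ℤ → X → ι) (μ : Measure X) (k : ℤ) (f : X → ℝ≥0∞) (x : X) : ℝ≥0∞ :=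
  (μ (dq π k x))⁻¹ * ∫⁻ y in dq π k x, f y ∂μ

lemma dq_meas {π : ℤ → X → ι} (hπ : ∀ k, Measurable (π k)) (k : ℤ) (x : X) :
    MeasurableSet (dq π k x) := hπ k (MeasurableSet.of_discrete)

lemma dq_congr {π : ℤ → X → ι} {k : ℤ} {x y : X} (h : π k x = π k y) :
    dq π k x = dq π k y := by
  simp [dq, h]

lemma dE_congr {π : ℤ → X → ι} {μ : Measure X} {k : ℤ} {f : X → ℝ≥0∞} {x y : X}
    (h : π k x = π k y) : dE π μ k f x = dE π μ k f y := by
  simp [dE, dq_congr h]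

lemma nest_le {π : ℤ → X → ι} (hn : ∀ k x y, π k x = π k y → π (k+1) x = π (k+1) y)
    {j k : ℤ} (hjk : j ≤ k) {x y : X} (h : π j x = π j y) : π k x = π k y := by
  induction k, hjk using Int.leInduction with
  | base => exact h
  | succ m _ ih => exact hn m x y ih

lemma meas_of_level {π : ℤ → X → ι} (hπ : ∀ k, Measurable (π k)) (k : ℤ) (g : X → ℝ≥0∞)
    (hg : ∀ x y, π k x = π k y → g x = g y) : Measurable g := by
  classical
  let G : ι → ℝ≥0∞ := fun i => if h : ∃ x, π k x = i then g h.choose else 0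
  have : g = G ∘ π k := by
    funext x
    have h : ∃ y, π k y = π k x := ⟨x, rfl⟩
    simp only [G, Function.comp, dif_pos h]
    exact hg _ _ h.choose_spec.symm
  rw [this]
  exact (Measurable.of_discrete).comp (hπ k)

lemma dE_meas {π : ℤ → X → ι} (hπ : ∀ k, Measurable (π k)) (μ : Measure X) (k : ℤ)
    (f : X → ℝ≥0∞) : Measurable (dE π μ k f) :=
  meas_of_level hπ k _ (fun _ _ h => dE_congr h)

lemma lint_split {π : ℤ → X → ι} (hπ : ∀ k, Measurable (π k)) (μ : Measure X) (k : ℤ)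
    (f : X → ℝ≥0∞) : ∫⁻ x, f x ∂μ = ∑' i, ∫⁻ x in π k ⁻¹' {i}, f x ∂μ := by
  rw [← lintegral_iUnion (fun i => hπ k (MeasurableSet.of_discrete))]
  · have : (⋃ i, π k ⁻¹' {i}) = Set.univ := by ext x; simp
    rw [this, setLIntegral_univ]
  · intro i j hij
    refine Set.disjoint_left.2 fun x hx hy => hij ?_
    simp at hx hy
    rw [← hx, ← hy]

/-- Compare integrals cube by cube. -/
lemma lint_le_of_cubes {π : ℤ → X → ι} (hπ : ∀ k, Measurable (π k)) (μ ν : Measure X) (k : ℤ)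
    (f g : X → ℝ≥0∞) (h : ∀ x, ∫⁻ y in dq π k x, f y ∂μ ≤ ∫⁻ y in dq π k x, g y ∂ν) :
    ∫⁻ x, f x ∂μ ≤ ∫⁻ x, g x ∂ν := by
  rw [lint_split hπ μ k, lint_split hπ ν k]
  refine ENNReal.tsum_le_tsum fun i => ?_
  by_cases hi : ∃ x, π k x = i
  · obtain ⟨x, rfl⟩ := hi
    exact h x
  · have : π k ⁻¹' {i} = ∅ := by
      ext x; simp only [mem_preimage, mem_singleton_iff, mem_empty_iff_false, iff_false]
      exact fun hx => hi ⟨x, hx⟩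
    simp [this]

lemma lint_dq_const {π : ℤ → X → ι} (hπ : ∀ k, Measurable (π k)) (μ : Measure X) (k : ℤ)
    (f g : X → ℝ≥0∞) (hg : ∀ x y, π k x = π k y → g x = g y) (hf : Measurable f) (x : X) :
    ∫⁻ y in dq π k x, g y * f y ∂μ = g x * ∫⁻ y in dq π k x, f y ∂μ := by
  rw [← lintegral_const_mul _ hf]
  refine setLIntegral_congr_fun (dq_meas hπ k x) fun y hy => ?_
  rw [hg y x hy]

lemma inv_mul_mul_le (a b : ℝ≥0∞) : a⁻¹ * b * a ≤ b := by
  rw [mul_right_comm]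
  calc _ ≤ 1 * b := by gcongr; exact ENNReal.inv_mul_le_one a
    _ = b := one_mul b

/-- `∫ φ E_k f ≤ ∫ φ f` for `φ` constant on cubes. -/
lemma lint_mul_dE_le {π : ℤ → X → ι} (hπ : ∀ k, Measurable (π k)) (μ : Measure X) (k : ℤ)
    (f g : X → ℝ≥0∞) (hg : ∀ x y, π k x = π k y → g x = g y) (hf : Measurable f) :
    ∫⁻ x, g x * dE π μ k f x ∂μ ≤ ∫⁻ x, g x * f x ∂μ := by
  refine lint_le_of_cubes hπ μ μ k _ _ fun x => ?_
  rw [lint_dq_const hπ μ k _ g hg hf, lint_dq_const hπ μ k _ g hg (dE_meas hπ μ k f)]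
  refine mul_le_mul_right ?_ _
  have : ∫⁻ y in dq π k x, dE π μ k f y ∂μ = ∫⁻ y in dq π k x, dE π μ k f x ∂μ :=
    setLIntegral_congr_fun (dq_meas hπ k x) fun y hy => dE_congr hy
  rw [this, lintegral_const, dE]
  simp only [MeasurableSet.univ, Measure.restrict_apply, univ_inter]
  exact inv_mul_mul_le _ _

lemma setLint_dE_le {π : ℤ → X → ι} (hπ : ∀ k, Measurable (π k)) (μ : Measure X) (k : ℤ)
    (f : X → ℝ≥0∞) (hf : Measurable f) (A : Set X) (hA : MeasurableSet A)
    (hs : ∀ x y, π k x = π k y → x ∈ A → y ∈ A) :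
    ∫⁻ x in A, dE π μ k f x ∂μ ≤ ∫⁻ x in A, f x ∂μ := by
  have := lint_mul_dE_le hπ μ k f (A.indicator 1) (fun x y h => by
    by_cases hx : x ∈ A
    · simp [hx, hs x y h hx]
    · have : y ∉ A := fun hy => hx (hs y x h.symm hy)
      simp [hx, this]) hf
  rw [← lintegral_indicator hA, ← lintegral_indicator hA]
  convert this using 2 <;>
  · funext x; by_cases hx : x ∈ A <;> simp [hx]

/-- finite maximal function -/
def dM (π : ℤ → X → ι) (μ : Measure X) (K : Finset ℤ) (f : X → ℝ≥0∞) (x : X) : ℝ≥0∞ :=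
  K.sup (fun k => dE π μ k f x)

lemma dM_meas {π : ℤ → X → ι} (hπ : ∀ k, Measurable (π k)) (μ : Measure X) (K : Finset ℤ)
    (f : X → ℝ≥0∞) : Measurable (dM π μ K f) := by
  have : dM π μ K f = fun x => ⨆ k ∈ K, dE π μ k f x := by
    funext x; simp [dM, Finset.sup_eq_iSup]
  rw [this]
  exact Measurable.biSup _ K.countable_toSet (fun k _ => dE_meas hπ μ k f)

lemma weak_type {π : ℤ → X → ι} (hπ : ∀ k, Measurable (π k))
    (hn : ∀ k x y, π k x = π k y → π (k+1) x = π (k+1) y) (μ : Measure X) (K : Finset ℤ)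
    (f : X → ℝ≥0∞) (hf : Measurable f) (t : ℝ≥0∞) :
    t * μ {x | t < dM π μ K f x} ≤ ∫⁻ x in {x | t < dM π μ K f x}, f x ∂μ := by
  induction K using Finset.induction_on_min with
  | empty => simp [dM]
  | insert a s ha ih =>
    set A := {x | t < dM π μ s f x} with hA
    set B := {x | t < dE π μ a f x} \ A with hB
    have hAm : MeasurableSet A := measurableSet_lt measurable_const (dM_meas hπ μ s f)
    have hBm : MeasurableSet B :=
      (measurableSet_lt measurable_const (dE_meas hπ μ a f)).diff hAm
    have hU : {x | t < dM π μ (insert a s) f x} = A ∪ B := by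
      ext x
      simp only [dM, Finset.sup_insert, mem_setOf_eq, lt_sup_iff, A, B, mem_union, mem_diff]
      tauto
    have hd : Disjoint A B := disjoint_sdiff_right
    rw [hU, measure_union hd hBm, lintegral_union hBm hd, mul_add]
    refine add_le_add ih ?_
    calc t * μ B = ∫⁻ x in B, t ∂μ := by simp
      _ ≤ ∫⁻ x in B, dE π μ a f x ∂μ := by
          refine setLIntegral_mono' hBm fun x hx => hx.1.le
      _ ≤ _ := by
          refine setLint_dE_le hπ μ a f hf B hBm fun x y h hx => ?_
          have h1 : dM π μ s f x = dM π μ s f y := by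
            unfold dM
            refine Finset.sup_congr rfl fun k hk => dE_congr (nest_le hn (ha k hk).le h)
          refine ⟨?_, ?_⟩
          · have := hx.1
            simp only [mem_setOf_eq] at this ⊢
            rwa [← dE_congr h]
          · have := hx.2
            simp only [A, mem_setOf_eq] at this ⊢
            rwa [← h1]

lemma absorb {J B : ℝ≥0∞} {r : ℝ} (hr : 0 < r) (hJ : J ≠ ∞) (h : J ≤ B * J ^ (1 - 1 / r)) :
    J ≤ B ^ r := by
  by_cases h0 : J = 0
  · simp [h0]
  have h1 : J = J ^ (1 / r) * J ^ (1 - 1 / r) := by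
    rw [← ENNReal.rpow_add _ _ h0 hJ]; simp
  have h2 : J ^ (1 / r) ≤ B := by
    have h3 : J ^ (1 - 1 / r) ≠ 0 := by
      simp [ENNReal.rpow_eq_zero_iff, h0, hJ]
    have h4 : J ^ (1 - 1 / r) ≠ ∞ := by
      simp [ENNReal.rpow_eq_top_iff, h0, hJ]
    rw [h1] at h
    rw [← h1] at h
    have h5 : J ^ (1 / r) * J ^ (1 - 1 / r) ≤ B * J ^ (1 - 1 / r) := by rw [← h1]; exact h
    exact (ENNReal.mul_le_mul_iff_left h3 h4).1 h5
  calc J = (J ^ (1 / r)) ^ r := by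
        rw [← ENNReal.rpow_mul]; field_simp; simp
    _ ≤ _ := ENNReal.rpow_le_rpow h2 hr.le

lemma jensen_avg {Y : Type*} [MeasurableSpace Y] (ν : Measure Y) (hν : ν univ ≠ ∞) {r : ℝ}
    (hr : 1 < r) (f : Y → ℝ≥0∞) (hf : Measurable f) :
    ((ν univ)⁻¹ * ∫⁻ y, f y ∂ν) ^ r ≤ (ν univ)⁻¹ * ∫⁻ y, f y ^ r ∂ν := by
  by_cases h0 : ν univ = 0
  · have : ν = 0 := Measure.measure_univ_eq_zero.1 h0
    subst this
    simp; linarith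
  have hpq : r.HolderConjugate (r / (r - 1)) := Real.HolderConjugate.conjExponent hr
  have h1 := ENNReal.lintegral_mul_le_Lp_mul_Lq ν hpq hf.aemeasurable
    (aemeasurable_const (b := (1 : ℝ≥0∞)))
  simp only [Pi.mul_apply, mul_one, ENNReal.one_rpow, lintegral_const, one_mul] at h1
  have hr0 : 0 < r := by linarith
  calc ((ν univ)⁻¹ * ∫⁻ y, f y ∂ν) ^ r
      ≤ ((ν univ)⁻¹ * ((∫⁻ y, f y ^ r ∂ν) ^ (1 / r) * ν univ ^ (1 / (r / (r - 1))))) ^ r := by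
        gcongr
    _ = ((ν univ) ^ (-r) * ν univ ^ (r - 1)) * ∫⁻ y, f y ^ r ∂ν := by
        rw [ENNReal.mul_rpow_of_nonneg _ _ hr0.le, ENNReal.mul_rpow_of_nonneg _ _ hr0.le,
          ← ENNReal.rpow_mul, ← ENNReal.rpow_mul, ← ENNReal.rpow_neg_one, ← ENNReal.rpow_mul]
        have e1 : 1 / r * r = 1 := by field_simp
        have e2 : 1 / (r / (r - 1)) * r = r - 1 := by field_simp
        rw [e1, e2]; simp only [ENNReal.rpow_one, neg_mul, one_mul]
        ring
    _ = _ := by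
        rw [← ENNReal.rpow_add _ _ h0 hν]
        have : -r + (r - 1) = -1 := by ring
        rw [this, ENNReal.rpow_neg_one]

lemma dE_rpow_le {π : ℤ → X → ι} (μ : Measure X) (k : ℤ)
    (hμ : ∀ x, μ (dq π k x) ≠ ∞) {r : ℝ} (hr : 1 < r)
    (f : X → ℝ≥0∞) (hf : Measurable f) (x : X) :
    dE π μ k f x ^ r ≤ dE π μ k (fun y => f y ^ r) x := by
  have := jensen_avg (μ.restrict (dq π k x)) (by simpa using hμ x) hr f hf
  simpa [dE] using this

lemma dE_ne_top {π : ℤ → X → ι} (μ : Measure X) (k : ℤ)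
    (f : X → ℝ≥0∞) (hf : ∫⁻ x, f x ∂μ ≠ ∞) (x : X) :
    dE π μ k f x ≠ ∞ := by
  by_cases h0 : μ (dq π k x) = 0
  · simp [dE, h0, Measure.restrict_eq_zero.2 h0]
  · refine ENNReal.mul_ne_top (by simpa using h0) ?_
    exact ne_top_of_le_ne_top hf (setLIntegral_le_lintegral _ _)

lemma lint_dE_le {π : ℤ → X → ι} (hπ : ∀ k, Measurable (π k)) (μ : Measure X) (k : ℤ)
    (f : X → ℝ≥0∞) (hf : Measurable f) : ∫⁻ x, dE π μ k f x ∂μ ≤ ∫⁻ x, f x ∂μ := by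
  simpa using lint_mul_dE_le hπ μ k f (fun _ => 1) (fun _ _ _ => rfl) hf

lemma layer {f M : X → ℝ≥0∞} (μ : Measure X) (hf : Measurable f) (hM : Measurable M)
    (hfin : ∀ x, M x ≠ ∞) {r : ℝ} (hr : 1 < r)
    (hw : ∀ t : ℝ≥0∞, t * μ {x | t < M x} ≤ ∫⁻ x in {x | t < M x}, f x ∂μ) :
    ∫⁻ x, M x ^ r ∂μ ≤ ENNReal.ofReal (r / (r - 1)) * ∫⁻ x, f x * M x ^ (r - 1) ∂μ := by
  have hr1 : 0 < r - 1 := by linarith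
  have e : ∀ (s : ℝ), 0 < s → ∀ x, M x ^ s = ENNReal.ofReal ((M x).toReal ^ s) := fun s hs x => by
    rw [← ENNReal.ofReal_rpow_of_nonneg ENNReal.toReal_nonneg hs.le,
      ENNReal.ofReal_toReal (hfin x)]
  have e2 : ∫⁻ x, f x * M x ^ (r - 1) ∂μ = ∫⁻ x, M x ^ (r - 1) ∂(μ.withDensity f) := by
    rw [lintegral_withDensity_eq_lintegral_mul _ hf (hM.pow_const _)]; rfl
  rw [e2]
  simp_rw [e r (by linarith), e (r - 1) hr1]
  rw [lintegral_rpow_eq_lintegral_meas_lt_mul _ (ae_of_all _ fun x => ENNReal.toReal_nonneg)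
    hM.ennreal_toReal.aemeasurable (by linarith),
    lintegral_rpow_eq_lintegral_meas_lt_mul _ (ae_of_all _ fun x => ENNReal.toReal_nonneg)
    hM.ennreal_toReal.aemeasurable hr1, ← mul_assoc, ← ENNReal.ofReal_mul (by positivity)]
  have : r / (r - 1) * (r - 1) = r := by field_simp
  rw [this]
  gcongr 1
  refine setLIntegral_mono' measurableSet_Ioi fun t ht => ?_
  have ht : 0 < t := ht
  have hset : {a | t < (M a).toReal} = {a | ENNReal.ofReal t < M a} := by
    ext a
    exact (ENNReal.ofReal_lt_iff_lt_toReal ht.le (hfin a)).symm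
  have hm : MeasurableSet {a | ENNReal.ofReal t < M a} := measurableSet_lt measurable_const hM
  rw [hset, withDensity_apply _ hm]
  calc μ {a | ENNReal.ofReal t < M a} * ENNReal.ofReal (t ^ (r - 1))
      = (ENNReal.ofReal t * μ {a | ENNReal.ofReal t < M a}) * ENNReal.ofReal (t ^ (r - 1 - 1)) := by
        have : t ^ (r - 1) = t * t ^ (r - 1 - 1) := by
          rw [Real.rpow_sub_one ht.ne' (r - 1)]; field_simp
        rw [this, ENNReal.ofReal_mul ht.le]; ring
    _ ≤ _ := by gcongr; exact hw _

lemma strong_type {π : ℤ → X → ι} (hπ : ∀ k, Measurable (π k))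
    (hn : ∀ k x y, π k x = π k y → π (k+1) x = π (k+1) y) (μ : Measure X)
    (hμ : ∀ k x, μ (dq π k x) ≠ ∞) (K : Finset ℤ)
    (f : X → ℝ≥0∞) (hf : Measurable f) {r : ℝ} (hr : 1 < r) :
    ∫⁻ x, dM π μ K f x ^ r ∂μ ≤ ENNReal.ofReal (r / (r - 1)) ^ r * ∫⁻ x, f x ^ r ∂μ := by
  have hr0 : 0 < r := by linarith
  have hr1 : 0 < r - 1 := by linarith
  by_cases htop : ∫⁻ x, f x ^ r ∂μ = ∞
  · rw [htop, ENNReal.mul_top]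
    · exact le_top
    · have : 0 < r / (r - 1) := by positivity
      simp [ENNReal.rpow_eq_zero_iff, hr0.not_gt, this.not_ge]
  have hEr : ∀ k x, dE π μ k (fun y => f y ^ r) x ≠ ∞ := fun k x => dE_ne_top μ k _ htop x
  have hfin : ∀ k x, dE π μ k f x ≠ ∞ := fun k x h => by
    have := dE_rpow_le μ k (hμ k) hr f hf x
    rw [h, ENNReal.top_rpow_of_pos hr0, top_le_iff] at this
    exact hEr k x this
  have hMfin : ∀ x, dM π μ K f x ≠ ∞ := fun x => by
    rw [← lt_top_iff_ne_top, dM, Finset.sup_lt_iff (by simp)]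
    exact fun k _ => (hfin k x).lt_top
  have hMm := dM_meas hπ μ K f
  have hMr : ∀ x, dM π μ K f x ^ r ≤ ∑ k ∈ K, dE π μ k f x ^ r := fun x => by
    rcases K.eq_empty_or_nonempty with h | h
    · simp [h, dM, hr0]
    · obtain ⟨i, hi, h2⟩ := Finset.exists_mem_eq_sup K h (fun k => dE π μ k f x)
      rw [dM, h2]
      exact Finset.single_le_sum (f := fun k => dE π μ k f x ^ r) (fun _ _ => zero_le) hi
  have hJ : ∫⁻ x, dM π μ K f x ^ r ∂μ ≠ ∞ := by
    refine ne_top_of_le_ne_top (b := ∑ k ∈ K, ∫⁻ x, f x ^ r ∂μ) ?_ ?_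
    · simp [ENNReal.mul_eq_top, htop]
    · calc _ ≤ ∫⁻ x, ∑ k ∈ K, dE π μ k f x ^ r ∂μ := lintegral_mono hMr
        _ = ∑ k ∈ K, ∫⁻ x, dE π μ k f x ^ r ∂μ :=
          lintegral_finsetSum _ fun k _ => (dE_meas hπ μ k f).pow_const r
        _ ≤ _ := Finset.sum_le_sum fun k _ =>
          (lintegral_mono fun x => dE_rpow_le μ k (hμ k) hr f hf x).trans
            (lint_dE_le hπ μ k _ (hf.pow_const r))
  have h1 := layer μ hf hMm hMfin hr (weak_type hπ hn μ K f hf)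
  have hpq : r.HolderConjugate (r / (r - 1)) := Real.HolderConjugate.conjExponent hr
  have h2 := ENNReal.lintegral_mul_le_Lp_mul_Lq μ hpq hf.aemeasurable
    (hMm.pow_const (r - 1)).aemeasurable
  simp only [Pi.mul_apply, ← ENNReal.rpow_mul] at h2
  have e1 : (r - 1) * (r / (r - 1)) = r := by field_simp
  have e2 : 1 / (r / (r - 1)) = 1 - 1 / r := by field_simp
  rw [e1, e2] at h2
  have h3 := absorb (B := ENNReal.ofReal (r / (r - 1)) * (∫⁻ x, f x ^ r ∂μ) ^ (1 / r)) hr0 hJ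
    (by rw [mul_assoc]; exact h1.trans (by gcongr))
  refine h3.trans (le_of_eq ?_)
  rw [ENNReal.mul_rpow_of_nonneg _ _ hr0.le, ← ENNReal.rpow_mul]
  have : 1 / r * r = 1 := by field_simp
  rw [this, ENNReal.rpow_one]

lemma sq_sum_le (μ : Measure X) (S : ℤ → X → ℝ≥0∞) (hS : ∀ k, Measurable (S k)) (d : ℤ → ℝ≥0∞)
    (hd : ∀ j k, ∫⁻ x, S j x * S k x ∂μ ≤
      d (j - k) * (∫⁻ x, S j x * S j x ∂μ + ∫⁻ x, S k x * S k x ∂μ))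
    (hsym : ∀ m, d (-m) = d m) (K : Finset ℤ) :
    ∑ k ∈ K, ∫⁻ x, S k x * S k x ∂μ ≤
      (2 * ∑' m, d m) * ∫⁻ x, (K.sup fun k => S k x) ^ (2 : ℝ) ∂μ := by
  by_cases hC : ∑' m, d m = 0
  · have hd0 : ∀ m, d m = 0 := ENNReal.tsum_eq_zero.1 hC
    have : ∀ k, ∫⁻ x, S k x * S k x ∂μ = 0 := fun k => by
      have := hd k k
      rw [hd0, zero_mul] at this
      exact le_antisymm this zero_le
    simp [this]
  set P := ∫⁻ x, (K.sup fun k => S k x) ^ (2 : ℝ) ∂μ with hP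
  by_cases hPt : P = ∞
  · rw [hPt, ENNReal.mul_top (by simpa using hC)]; exact le_top
  set Y := ∑ k ∈ K, ∫⁻ x, S k x * S k x ∂μ with hY
  have hsup : ∀ x, ∀ k ∈ K, S k x ≤ K.sup fun k => S k x := fun x k hk =>
    Finset.le_sup (f := fun k => S k x) hk
  have hYt : Y ≠ ∞ := by
    refine ne_top_of_le_ne_top (b := ∑ k ∈ K, P) ?_ ?_
    · simp [ENNReal.mul_eq_top, hPt]
    · refine Finset.sum_le_sum fun k hk => lintegral_mono fun x => ?_
      rw [ENNReal.rpow_two, sq]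
      exact mul_le_mul' (hsup x k hk) (hsup x k hk)
  have hsm : Measurable fun x => K.sup fun k => S k x := by
    simp_rw [Finset.sup_eq_iSup]
    exact Measurable.biSup _ K.countable_toSet (fun k _ => hS k)
  have hVm : Measurable fun x => ∑ k ∈ K, S k x := Finset.measurable_fun_sum _ fun k _ => hS k
  have hV : ∫⁻ x, (∑ k ∈ K, S k x) ^ (2 : ℝ) ∂μ ≤ (2 * ∑' m, d m) * Y := by
    calc ∫⁻ x, (∑ k ∈ K, S k x) ^ (2 : ℝ) ∂μ
        = ∫⁻ x, ∑ j ∈ K, ∑ k ∈ K, S j x * S k x ∂μ := by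
          refine lintegral_congr fun x => ?_
          rw [ENNReal.rpow_two, sq, Finset.sum_mul_sum]
      _ = ∑ j ∈ K, ∑ k ∈ K, ∫⁻ x, S j x * S k x ∂μ := by
          rw [lintegral_finsetSum _ fun j _ => Finset.measurable_fun_sum _ fun k _ =>
            (hS j).fun_mul (hS k)]
          refine Finset.sum_congr rfl fun j _ => ?_
          rw [lintegral_finsetSum _ fun k _ => (hS j).fun_mul (hS k)]
      _ ≤ ∑ j ∈ K, ∑ k ∈ K, d (j - k) *
            (∫⁻ x, S j x * S j x ∂μ + ∫⁻ x, S k x * S k x ∂μ) :=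
          Finset.sum_le_sum fun j _ => Finset.sum_le_sum fun k _ => hd j k
      _ = ∑ j ∈ K, (∑ k ∈ K, d (j - k)) * ∫⁻ x, S j x * S j x ∂μ +
          ∑ k ∈ K, (∑ j ∈ K, d (j - k)) * ∫⁻ x, S k x * S k x ∂μ := by
          simp_rw [mul_add, Finset.sum_add_distrib, Finset.sum_mul]
          congr 1
          rw [Finset.sum_comm]
      _ ≤ ∑ j ∈ K, (∑' m, d m) * ∫⁻ x, S j x * S j x ∂μ +
          ∑ k ∈ K, (∑' m, d m) * ∫⁻ x, S k x * S k x ∂μ := by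
          have h1 : ∀ k, ∑ j ∈ K, d (j - k) ≤ ∑' m, d m := fun k =>
            (ENNReal.sum_le_tsum K).trans
              (le_of_eq ((Equiv.subRight k).tsum_eq d))
          have h2 : ∀ j, ∑ k ∈ K, d (j - k) ≤ ∑' m, d m := fun j => by
            refine le_trans (le_of_eq ?_) (h1 j)
            refine Finset.sum_congr rfl fun k _ => ?_
            rw [← hsym, neg_sub]
          gcongr
          · exact h2 _
          · exact h1 _
      _ = _ := by rw [← Finset.mul_sum]; ring
  have hY2 : Y ≤ (P ^ (1 / (2 : ℝ)) * (2 * ∑' m, d m) ^ (1 / (2 : ℝ))) * Y ^ (1 - 1 / (2 : ℝ)) := by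
    calc Y = ∫⁻ x, ∑ k ∈ K, S k x * S k x ∂μ := by
          rw [lintegral_finsetSum _ fun k _ => (hS k).fun_mul (hS k)]
      _ ≤ ∫⁻ x, ((fun x => K.sup fun k => S k x) * fun x => ∑ k ∈ K, S k x) x ∂μ := by
          refine lintegral_mono fun x => ?_
          simp only [Pi.mul_apply]
          rw [Finset.mul_sum]
          exact Finset.sum_le_sum fun k hk => mul_le_mul' (hsup x k hk) le_rfl
      _ ≤ P ^ (1 / (2 : ℝ)) * (∫⁻ x, (∑ k ∈ K, S k x) ^ (2 : ℝ) ∂μ) ^ (1 / (2 : ℝ)) :=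
          ENNReal.lintegral_mul_le_Lp_mul_Lq μ Real.HolderConjugate.two_two
            hsm.aemeasurable hVm.aemeasurable
      _ ≤ P ^ (1 / (2 : ℝ)) * ((2 * ∑' m, d m) * Y) ^ (1 / (2 : ℝ)) := by gcongr
      _ = _ := by
          rw [ENNReal.mul_rpow_of_nonneg _ Y (by norm_num), mul_assoc]
          norm_num
  refine (absorb (by norm_num) hYt hY2).trans (le_of_eq ?_)
  rw [← ENNReal.mul_rpow_of_nonneg _ _ (by norm_num), ← ENNReal.rpow_mul]
  norm_num
  ring

/-- Geometric mean of averages, scaled. -/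
def dS (π : ℤ → X → ι) (μ : Measure X) (a : ℝ) (F G : X → ℝ≥0∞) (k : ℤ) (x : X) : ℝ≥0∞ :=
  2 ^ (k * a) * (dE π μ k F x ^ (1 / (2 : ℝ)) * dE π μ k G x ^ (1 / (2 : ℝ)))

lemma dS_congr {π : ℤ → X → ι} {μ : Measure X} {a : ℝ} {F G : X → ℝ≥0∞} {k : ℤ} {x y : X}
    (h : π k x = π k y) : dS π μ a F G k x = dS π μ a F G k y := by
  simp [dS, dE_congr h]

lemma dS_meas {π : ℤ → X → ι} (hπ : ∀ k, Measurable (π k)) (μ : Measure X) (a : ℝ)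
    (F G : X → ℝ≥0∞) (k : ℤ) : Measurable (dS π μ a F G k) :=
  meas_of_level hπ k _ (fun _ _ h => dS_congr h)

lemma dS_cube {π : ℤ → X → ι} (hπ : ∀ k, Measurable (π k))
    (hn : ∀ k x y, π k x = π k y → π (k+1) x = π (k+1) y) (μ : Measure X)
    (hμ : ∀ k x, μ (dq π k x) ≠ ∞) (hμ0 : ∀ k x, μ (dq π k x) ≠ 0) (a : ℝ)
    (F G : X → ℝ≥0∞) (hF : Measurable F) (hG : Measurable G) {j k : ℤ} (hjk : j ≤ k) (x : X) :
    ∫⁻ y in dq π k x, dS π μ a F G j y ∂μ ≤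
      2 ^ ((j - k) * a) * (dS π μ a F G k x * μ (dq π k x)) := by
  have hsat : ∀ y z, π j y = π j z → y ∈ dq π k x → z ∈ dq π k x := fun y z h hy => by
    have := nest_le hn hjk h
    simp only [dq, mem_preimage, mem_singleton_iff] at hy ⊢
    rw [← this, hy]
  have hEm := fun (f : X → ℝ≥0∞) => dE_meas hπ μ j f
  have h1 : ∀ f, Measurable f → ∫⁻ y in dq π k x, dE π μ j f y ∂μ ≤
      dE π μ k f x * μ (dq π k x) := fun f hf => by
    refine (setLint_dE_le hπ μ j f hf _ (dq_meas hπ k x) hsat).trans (le_of_eq ?_)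
    rw [dE, mul_right_comm, ENNReal.inv_mul_cancel (hμ0 k x) (hμ k x), one_mul]
  unfold dS
  rw [lintegral_const_mul _ (((hEm F).pow_const _).fun_mul ((hEm G).pow_const _))]
  calc _ ≤ 2 ^ (j * a) * ((∫⁻ y in dq π k x, dE π μ j F y ∂μ) ^ (1 / (2 : ℝ)) *
        (∫⁻ y in dq π k x, dE π μ j G y ∂μ) ^ (1 / (2 : ℝ))) := by
        gcongr
        have := ENNReal.lintegral_mul_le_Lp_mul_Lq (μ.restrict (dq π k x))
          Real.HolderConjugate.two_two ((hEm F).pow_const (1 / (2 : ℝ))).aemeasurable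
          ((hEm G).pow_const (1 / (2 : ℝ))).aemeasurable
        simp only [← ENNReal.rpow_mul, Pi.mul_apply] at this
        norm_num at this ⊢
        exact this
    _ ≤ 2 ^ (j * a) * ((dE π μ k F x * μ (dq π k x)) ^ (1 / (2 : ℝ)) *
        (dE π μ k G x * μ (dq π k x)) ^ (1 / (2 : ℝ))) := by
        gcongr
        · exact h1 F hF
        · exact h1 G hG
    _ = _ := by
        rw [ENNReal.mul_rpow_of_nonneg _ _ (by norm_num), ENNReal.mul_rpow_of_nonneg _ _ (by norm_num)]
        have e1 : (2 : ℝ≥0∞) ^ (j * a) = 2 ^ ((j - k) * a) * 2 ^ (k * a) := by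
          rw [← ENNReal.rpow_add _ _ (by norm_num) (by norm_num)]; congr 1; ring
        have e2 : μ (dq π k x) ^ (1 / (2 : ℝ)) * μ (dq π k x) ^ (1 / (2 : ℝ)) = μ (dq π k x) := by
          rw [← ENNReal.rpow_add _ _ (hμ0 k x) (hμ k x)]; norm_num
        rw [e1]
        calc _ = 2 ^ ((j - k) * a) * 2 ^ (k * a) * (dE π μ k F x ^ (1 / (2 : ℝ)) *
            dE π μ k G x ^ (1 / (2 : ℝ))) *
            (μ (dq π k x) ^ (1 / (2 : ℝ)) * μ (dq π k x) ^ (1 / (2 : ℝ))) := by ring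
          _ = _ := by rw [e2]; ring

lemma dS_pair {π : ℤ → X → ι} (hπ : ∀ k, Measurable (π k))
    (hn : ∀ k x y, π k x = π k y → π (k+1) x = π (k+1) y) (μ : Measure X)
    (hμ : ∀ k x, μ (dq π k x) ≠ ∞) (hμ0 : ∀ k x, μ (dq π k x) ≠ 0) (a : ℝ)
    (F G : X → ℝ≥0∞) (hF : Measurable F) (hG : Measurable G) {j k : ℤ} (hjk : j ≤ k) :
    ∫⁻ x, dS π μ a F G k x * dS π μ a F G j x ∂μ ≤
      2 ^ ((j - k) * a) * ∫⁻ x, dS π μ a F G k x * dS π μ a F G k x ∂μ := by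
  have hm := dS_meas hπ μ a F G
  rw [← lintegral_const_mul _ ((hm k).fun_mul (hm k))]
  refine lint_le_of_cubes hπ μ μ k _ _ fun x => ?_
  rw [lint_dq_const hπ μ k _ _ (fun _ _ h => dS_congr h) (hm j)]
  have : ∫⁻ y in dq π k x, 2 ^ ((j - k) * a) * (dS π μ a F G k y * dS π μ a F G k y) ∂μ =
      ∫⁻ y in dq π k x, 2 ^ ((j - k) * a) * (dS π μ a F G k x * dS π μ a F G k x) ∂μ :=
    setLIntegral_congr_fun (dq_meas hπ k x) fun y hy => by
      rw [dS_congr (π := π) (x := y) (y := x) hy]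
  rw [this, setLIntegral_const]
  calc _ ≤ dS π μ a F G k x * (2 ^ ((j - k) * a) * (dS π μ a F G k x * μ (dq π k x))) := by
        gcongr; exact dS_cube hπ hn μ hμ hμ0 a F G hF hG hjk x
    _ = _ := by ring

/-- the geometric constant -/
def gC (a : ℝ) : ℝ≥0∞ := 2 * ∑' m : ℤ, (2 : ℝ≥0∞) ^ (-(|(m : ℝ)| * a))

lemma dS_main {π : ℤ → X → ι} (hπ : ∀ k, Measurable (π k))
    (hn : ∀ k x y, π k x = π k y → π (k+1) x = π (k+1) y) (μ : Measure X)
    (hμ : ∀ k x, μ (dq π k x) ≠ ∞) (hμ0 : ∀ k x, μ (dq π k x) ≠ 0) (a : ℝ)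
    (F G : X → ℝ≥0∞) (hF : Measurable F) (hG : Measurable G) (K : Finset ℤ) :
    ∑ k ∈ K, ∫⁻ x, dS π μ a F G k x * dS π μ a F G k x ∂μ ≤
      gC a * ∫⁻ x, (K.sup fun k => dS π μ a F G k x) ^ (2 : ℝ) ∂μ := by
  refine sq_sum_le μ _ (dS_meas hπ μ a F G) (fun m => 2 ^ (-(|(m : ℝ)| * a))) ?_ ?_ K
  · intro j k
    rcases le_total j k with h | h
    · have h1 := dS_pair hπ hn μ hμ hμ0 a F G hF hG h
      have e : -(|((j - k : ℤ) : ℝ)| * a) = (j - k) * a := by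
        have : (j : ℝ) ≤ k := by exact_mod_cast h
        rw [abs_of_nonpos (by push_cast; linarith)]; push_cast; ring
      simp_rw [mul_comm (dS π μ a F G j _) (dS π μ a F G k _)]
      rw [e]
      refine h1.trans ?_
      gcongr
      exact le_add_self
    · have h1 := dS_pair hπ hn μ hμ hμ0 a F G hF hG h
      have e : -(|((j - k : ℤ) : ℝ)| * a) = (k - j) * a := by
        have : (k : ℝ) ≤ j := by exact_mod_cast h
        rw [abs_of_nonneg (by push_cast; linarith)]; push_cast; ring
      rw [e]
      refine h1.trans ?_
      gcongr
      exact le_self_add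
  · intro m; simp

lemma gC_ne_top {a : ℝ} (ha : 0 < a) : gC a ≠ ∞ := by
  unfold gC
  refine ENNReal.mul_ne_top (by norm_num) ?_
  have key : ∀ n : ℕ, (2 : ℝ≥0∞) ^ (-((n : ℝ) * a)) = ((2 : ℝ≥0∞) ^ (-a)) ^ n := fun n => by
    rw [← ENNReal.rpow_natCast, ← ENNReal.rpow_mul]; congr 1; ring
  have hlt : (2 : ℝ≥0∞) ^ (-a) < 1 := ENNReal.rpow_lt_one_of_one_lt_of_neg (by norm_num) (by linarith)
  have hs : ∑' n : ℕ, (2 : ℝ≥0∞) ^ (-((n : ℝ) * a)) ≠ ∞ := by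
    simp_rw [key]
    rw [ENNReal.tsum_geometric]
    simp [tsub_eq_zero_iff_le, hlt.not_ge]
  rw [tsum_of_nat_of_neg_add_one ENNReal.summable ENNReal.summable]
  refine ENNReal.add_ne_top.2 ⟨by simpa using hs, ?_⟩
  refine ne_top_of_le_ne_top hs (ENNReal.tsum_le_tsum fun n => ?_)
  refine ENNReal.rpow_le_rpow_of_exponent_le (by norm_num) ?_
  have : |((-((n : ℤ) + 1) : ℤ) : ℝ)| = n + 1 := by
    push_cast
    rw [abs_of_nonpos (by linarith [(Nat.cast_nonneg n : (0 : ℝ) ≤ n)])]; ring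
  rw [this]
  nlinarith

/-- the constant in the bilinear estimate -/
def bC (a p q : ℝ) : ℝ≥0∞ :=
  gC a * ((ENNReal.ofReal (p / (p - 1)) ^ p) ^ (1 / q) *
    ((ENNReal.ofReal ((q / (q - 1)) / (q / (q - 1) - 1)) ^ (q / (q - 1))) ^ (1 / (q / (q - 1)))))

lemma bilinear {π : ℤ → X → ι} (hπ : ∀ k, Measurable (π k))
    (hn : ∀ k x y, π k x = π k y → π (k+1) x = π (k+1) y) (μ : Measure X) (d δ : ℝ)
    (hμ : ∀ k x, μ (dq π k x) = 2 ^ (k * d)) (hδ : 0 < δ)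
    (s u : X → ℝ≥0∞) (hs : Measurable s) (hu : Measurable u)
    (hs0 : ∀ k x, μ.withDensity s (dq π k x) ≠ 0) (hst : ∀ k x, μ.withDensity s (dq π k x) ≠ ∞)
    (hu0 : ∀ k x, μ.withDensity u (dq π k x) ≠ 0) (hut : ∀ k x, μ.withDensity u (dq π k x) ≠ ∞)
    (A : ℝ≥0∞)
    (hA : ∀ k x, μ.withDensity u (dq π k x) * μ.withDensity s (dq π k x) ^ (1 - δ) ≤
      A * μ (dq π k x) ^ (2 - δ))
    (p q : ℝ) (hp : 1 < p) (hq : 1 < q) (hpq : 1 / q = 1 / p - δ)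
    (he : ∀ᵐ x ∂μ, s x ^ (1 / q) * u x ^ (1 / (q / (q - 1))) = 1)
    (f g : X → ℝ≥0∞) (hf : Measurable f) (hg : Measurable g) (K : Finset ℤ) :
    ∑ k ∈ K, ∫⁻ x, (2 ^ (k * (δ * d - d)) * ∫⁻ y in dq π k x, s y * f y ∂μ) * (u x * g x) ∂μ ≤
      bC (δ * d / 2) p q * A * (∫⁻ x, s x * f x ^ p ∂μ) ^ (1 / p) *
        (∫⁻ x, u x * g x ^ (q / (q - 1)) ∂μ) ^ (1 / (q / (q - 1))) := by
  have h20 : (2 : ℝ≥0∞) ≠ 0 := by norm_num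
  have h2t : (2 : ℝ≥0∞) ≠ ∞ := by norm_num
  have hμ0 : ∀ k x, μ (dq π k x) ≠ 0 := fun k x => by
    rw [hμ]; exact (ENNReal.rpow_pos (by norm_num) h2t).ne'
  have hμt : ∀ k x, μ (dq π k x) ≠ ∞ := fun k x => by
    rw [hμ]; exact ENNReal.rpow_ne_top_of_ne_zero h20 h2t
  set F : X → ℝ≥0∞ := fun x => s x * f x with hF
  set G : X → ℝ≥0∞ := fun x => u x * g x with hG
  have hFm : Measurable F := hs.mul hf
  have hGm : Measurable G := hu.mul hg
  set a := δ * d / 2 with ha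
  set S := dS π μ a F G with hS
  set q' := q / (q - 1) with hq'
  have hq'1 : 1 < q' := by rw [hq', lt_div_iff₀ (by linarith)]; linarith
  have hp0 : 0 < p := by linarith
  have hq0 : 0 < q := by linarith
  have hSS : ∀ k x, S k x * S k x = μ (dq π k x) ^ δ * (dE π μ k F x * dE π μ k G x) := by
    intro k x
    have e1 : ∀ z : ℝ≥0∞, z ^ (1 / (2 : ℝ)) * z ^ (1 / (2 : ℝ)) = z := fun z => by
      rw [← ENNReal.rpow_add_of_nonneg _ _ (by norm_num) (by norm_num)]; norm_num
    have e2 : (2 : ℝ≥0∞) ^ (k * a) * 2 ^ (k * a) = μ (dq π k x) ^ δ := by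
      rw [hμ, ← ENNReal.rpow_add _ _ h20 h2t, ← ENNReal.rpow_mul]; congr 1; rw [ha]; ring
    rw [hS, dS]
    calc _ = ((2 : ℝ≥0∞) ^ (k * a) * 2 ^ (k * a)) *
          ((dE π μ k F x ^ (1 / (2 : ℝ)) * dE π μ k F x ^ (1 / (2 : ℝ))) *
          (dE π μ k G x ^ (1 / (2 : ℝ)) * dE π μ k G x ^ (1 / (2 : ℝ)))) := by ring
      _ = _ := by rw [e1, e1, e2]
  have step1 : ∀ k : ℤ, ∫⁻ x, (2 ^ (k * (δ * d - d)) * ∫⁻ y in dq π k x, F y ∂μ) * G x ∂μ ≤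
      ∫⁻ x, S k x * S k x ∂μ := by
    intro k
    refine lint_le_of_cubes hπ μ μ k _ _ fun x => ?_
    rw [lint_dq_const hπ μ k G (fun x => 2 ^ (k * (δ * d - d)) * ∫⁻ y in dq π k x, F y ∂μ)
      (fun x y h => by simp only [dq_congr h]) hGm]
    have : ∫⁻ y in dq π k x, S k y * S k y ∂μ = ∫⁻ y in dq π k x, S k x * S k x ∂μ :=
      setLIntegral_congr_fun (dq_meas hπ k x) fun y hy => by
        rw [hS, dS_congr (π := π) (x := y) (y := x) hy]
    rw [this, setLIntegral_const, hSS]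
    refine le_of_eq ?_
    unfold dE
    have e3 : (2 : ℝ≥0∞) ^ (k * (δ * d - d)) = μ (dq π k x) ^ δ * (μ (dq π k x))⁻¹ := by
      rw [hμ, ← ENNReal.rpow_mul, ← ENNReal.rpow_neg, ← ENNReal.rpow_add _ _ h20 h2t]
      congr 1; ring
    rw [e3]
    calc _ = μ (dq π k x) ^ δ * (μ (dq π k x))⁻¹ * 1 * (∫⁻ y in dq π k x, F y ∂μ) *
            ∫⁻ y in dq π k x, G y ∂μ := by ring
      _ = μ (dq π k x) ^ δ * (μ (dq π k x))⁻¹ * ((μ (dq π k x))⁻¹ * μ (dq π k x)) *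
            (∫⁻ y in dq π k x, F y ∂μ) * ∫⁻ y in dq π k x, G y ∂μ := by
          rw [ENNReal.inv_mul_cancel (hμ0 k x) (hμt k x)]
      _ = _ := by ring
  set ms := μ.withDensity s with hms
  set mu := μ.withDensity u with hmu
  set N := ∫⁻ x, f x ^ p ∂ms with hN
  have hNe : N = ∫⁻ x, s x * f x ^ p ∂μ := by
    rw [hN, hms, lintegral_withDensity_eq_lintegral_mul _ hs (hf.pow_const p)]; rfl
  have hEF : ∀ (t : X → ℝ≥0∞) (ht : Measurable t) (h : X → ℝ≥0∞) (hh : Measurable h) (k : ℤ) (x : X),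
      μ.withDensity t (dq π k x) ≠ 0 → μ.withDensity t (dq π k x) ≠ ∞ →
      dE π μ k (fun y => t y * h y) x =
        (μ (dq π k x))⁻¹ * μ.withDensity t (dq π k x) * dE π (μ.withDensity t) k h x := by
    intro t ht h hh k x h0 h1
    unfold dE
    rw [setLIntegral_withDensity_eq_setLIntegral_mul _ ht hh (dq_meas hπ k x)]
    rw [mul_assoc, ← mul_assoc (μ.withDensity t (dq π k x)), ENNReal.mul_inv_cancel h0 h1, one_mul]
    rfl
  have step3 : ∀ k x, ms (dq π k x) ^ δ * dE π ms k f x ≤ N ^ δ * dE π ms k f x ^ (p / q) := by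
    intro k x
    have hpδ : p * δ = 1 - p / q := by
      have : δ = 1 / p - 1 / q := by linarith
      rw [this]; field_simp
    have h1 := dE_rpow_le ms k (hst k) hp f hf x
    have h2 : ms (dq π k x) * dE π ms k f x ^ p ≤ N := by
      calc _ ≤ ms (dq π k x) * dE π ms k (fun y => f y ^ p) x := by gcongr
        _ = ∫⁻ y in dq π k x, f y ^ p ∂ms := by
          rw [dE, ← mul_assoc, ENNReal.mul_inv_cancel (hs0 k x) (hst k x), one_mul]
        _ ≤ N := setLIntegral_le_lintegral _ _
    have h3 : dE π ms k f x = dE π ms k f x ^ (p * δ) * dE π ms k f x ^ (p / q) := by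
      rw [← ENNReal.rpow_add_of_nonneg _ _ (by positivity) (by positivity), hpδ]; simp
    calc _ = ms (dq π k x) ^ δ * (dE π ms k f x ^ (p * δ) * dE π ms k f x ^ (p / q)) := by
          rw [← h3]
      _ = (ms (dq π k x) * dE π ms k f x ^ p) ^ δ * dE π ms k f x ^ (p / q) := by
          rw [ENNReal.mul_rpow_of_nonneg _ _ hδ.le, ENNReal.rpow_mul]; ring
      _ ≤ _ := by gcongr
  have step2 : ∀ k x, S k x * S k x ≤
      A * N ^ δ * (dE π ms k f x ^ (p / q) * dE π mu k g x) := by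
    intro k x
    rw [hSS, hF, hG, hEF s hs f hf k x (hs0 k x) (hst k x), hEF u hu g hg k x (hu0 k x) (hut k x)]
    set m := μ (dq π k x)
    have hm0 : m ≠ 0 := hμ0 k x
    have hmt : m ≠ ∞ := hμt k x
    have hsplit : ms (dq π k x) = ms (dq π k x) ^ (1 - δ) * ms (dq π k x) ^ δ := by
      rw [← ENNReal.rpow_add _ _ (hs0 k x) (hst k x)]; simp
    have hm1 : m ^ δ * m⁻¹ * m⁻¹ * m ^ (2 - δ) = 1 := by
      rw [← ENNReal.rpow_neg_one, ← ENNReal.rpow_add _ _ hm0 hmt, ← ENNReal.rpow_add _ _ hm0 hmt,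
        ← ENNReal.rpow_add _ _ hm0 hmt]
      have : δ + -1 + -1 + (2 - δ) = 0 := by ring
      rw [this, ENNReal.rpow_zero]
    calc _ = m ^ δ * m⁻¹ * m⁻¹ * (mu (dq π k x) * ms (dq π k x)) *
          (dE π ms k f x * dE π mu k g x) := by ring
      _ = m ^ δ * m⁻¹ * m⁻¹ * (mu (dq π k x) * ms (dq π k x) ^ (1 - δ)) * ms (dq π k x) ^ δ *
          (dE π ms k f x * dE π mu k g x) := by
          conv_lhs => rw [hsplit]
          ring
      _ ≤ m ^ δ * m⁻¹ * m⁻¹ * (A * m ^ (2 - δ)) * ms (dq π k x) ^ δ *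
          (dE π ms k f x * dE π mu k g x) := by 
          gcongr m ^ δ * m⁻¹ * m⁻¹ * ?_ * _ * _
          exact hA k x
      _ = (m ^ δ * m⁻¹ * m⁻¹ * m ^ (2 - δ)) * A * (ms (dq π k x) ^ δ * dE π ms k f x) *
            dE π mu k g x := by ring
      _ ≤ 1 * A * (N ^ δ * dE π ms k f x ^ (p / q)) * dE π mu k g x := by
          rw [hm1]
          gcongr 1 * A * ?_ * _
          exact step3 k x
      _ = _ := by ring
  have hMf := dM_meas hπ ms K f
  have hMg := dM_meas hπ mu K g
  have step2' : ∀ x, (K.sup fun k => S k x) ^ (2 : ℝ) ≤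
      A * N ^ δ * (dM π ms K f x ^ (p / q) * dM π mu K g x) := by
    intro x
    rcases K.eq_empty_or_nonempty with h | h
    · simp [h]
    · obtain ⟨k, hk, h2⟩ := Finset.exists_mem_eq_sup K h (fun k => S k x)
      rw [h2, ENNReal.rpow_two, sq]
      refine (step2 k x).trans ?_
      gcongr
      · exact Finset.le_sup (f := fun k => dE π ms k f x) hk
      · exact Finset.le_sup (f := fun k => dE π mu k g x) hk
  have hconj : q.HolderConjugate q' := Real.HolderConjugate.conjExponent hq
  have step4 : ∫⁻ x, dM π ms K f x ^ (p / q) * dM π mu K g x ∂μ ≤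
      (ENNReal.ofReal (p / (p - 1)) ^ p * N) ^ (1 / q) *
        (ENNReal.ofReal (q' / (q' - 1)) ^ q' * ∫⁻ x, g x ^ q' ∂mu) ^ (1 / q') := by
    calc _ = ∫⁻ x, ((fun x => s x ^ (1 / q) * dM π ms K f x ^ (p / q)) *
            (fun x => u x ^ (1 / q') * dM π mu K g x)) x ∂μ := by
          refine lintegral_congr_ae ?_
          filter_upwards [he] with x hx
          simp only [Pi.mul_apply]
          calc _ = 1 * (dM π ms K f x ^ (p / q) * dM π mu K g x) := by rw [one_mul]
            _ = _ := by rw [← hx]; ring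
      _ ≤ _ := ENNReal.lintegral_mul_le_Lp_mul_Lq μ hconj
          ((hs.pow_const _).mul (hMf.pow_const _)).aemeasurable
          ((hu.pow_const _).mul hMg).aemeasurable
      _ = (∫⁻ x, dM π ms K f x ^ p ∂ms) ^ (1 / q) * (∫⁻ x, dM π mu K g x ^ q' ∂mu) ^ (1 / q') := by
          rw [hms, hmu, lintegral_withDensity_eq_lintegral_mul _ hs (hMf.pow_const p),
            lintegral_withDensity_eq_lintegral_mul _ hu (hMg.pow_const q')]
          congr 2
          · refine lintegral_congr fun x => ?_
            rw [ENNReal.mul_rpow_of_nonneg _ _ hq0.le, ← ENNReal.rpow_mul, ← ENNReal.rpow_mul]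
            have e1 : 1 / q * q = 1 := by field_simp
            have e2 : p / q * q = p := by field_simp
            rw [e1, e2, ENNReal.rpow_one]; rfl
          · refine lintegral_congr fun x => ?_
            have e1 : 1 / q' * q' = 1 := by have : q' ≠ 0 := by linarith
                                            field_simp
            rw [ENNReal.mul_rpow_of_nonneg _ _ (by linarith), ← ENNReal.rpow_mul]
            rw [e1, ENNReal.rpow_one]; rfl
      _ ≤ _ := by
          have hq'0 : 0 < q' := by linarith
          gcongr
          · exact strong_type hπ hn ms hst K f hf hp
          · exact strong_type hπ hn mu hut K g hg hq'1
  have hNg : ∫⁻ x, g x ^ q' ∂mu = ∫⁻ x, u x * g x ^ q' ∂μ := by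
    rw [hmu, lintegral_withDensity_eq_lintegral_mul _ hu (hg.pow_const q')]; rfl
  calc _ ≤ ∑ k ∈ K, ∫⁻ x, S k x * S k x ∂μ := Finset.sum_le_sum fun k _ => step1 k
    _ ≤ gC a * ∫⁻ x, (K.sup fun k => S k x) ^ (2 : ℝ) ∂μ :=
        dS_main hπ hn μ hμt hμ0 a F G hFm hGm K
    _ ≤ gC a * ∫⁻ x, A * N ^ δ * (dM π ms K f x ^ (p / q) * dM π mu K g x) ∂μ := by
        gcongr; exact step2' _
    _ = gC a * (A * N ^ δ * ∫⁻ x, dM π ms K f x ^ (p / q) * dM π mu K g x ∂μ) := by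
        rw [lintegral_const_mul _ ((hMf.pow_const _).fun_mul hMg)]
    _ ≤ gC a * (A * N ^ δ * ((ENNReal.ofReal (p / (p - 1)) ^ p * N) ^ (1 / q) *
        (ENNReal.ofReal (q' / (q' - 1)) ^ q' * ∫⁻ x, g x ^ q' ∂mu) ^ (1 / q'))) := by
        gcongr
    _ = _ := by
        have hq'0 : 0 ≤ 1 / q' := by have : 0 < q' := by linarith
                                     positivity
        rw [ENNReal.mul_rpow_of_nonneg _ N (by positivity),
          ENNReal.mul_rpow_of_nonneg _ (∫⁻ x, g x ^ q' ∂mu) hq'0, ← hNe, ← hNg]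
        have e : N ^ (1 / p) = N ^ δ * N ^ (1 / q) := by
          rw [← ENNReal.rpow_add_of_nonneg _ _ hδ.le (by positivity)]; congr 1; linarith
        rw [e, bC]; ring

lemma bC_ne_top {a p q : ℝ} (ha : 0 < a) (hp : 1 < p) (hq : 1 < q) : bC a p q ≠ ∞ := by
  have h1 : 0 < q / (q - 1) := div_pos (by linarith) (by linarith)
  unfold bC
  refine ENNReal.mul_ne_top (gC_ne_top ha) (ENNReal.mul_ne_top ?_ ?_)
  · refine ENNReal.rpow_ne_top_of_nonneg (by positivity)
      (ENNReal.rpow_ne_top_of_nonneg (by positivity) ENNReal.ofReal_ne_top)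
  · refine ENNReal.rpow_ne_top_of_nonneg (by positivity)
      (ENNReal.rpow_ne_top_of_nonneg h1.le ENNReal.ofReal_ne_top)

/-- Converse of Hölder by testing. -/
lemma dual_test (ν : Measure X) (h : X → ℝ≥0∞) (hh : Measurable h) {q : ℝ} (hq : 1 < q)
    (B : ℕ → Set X) (hB : ∀ i, MeasurableSet (B i)) (hmono : Monotone B)
    (hU : ⋃ i, B i = univ) (hfin : ∀ i, ν (B i) ≠ ∞) (C : ℝ≥0∞)
    (H : ∀ g : X → ℝ≥0∞, Measurable g →
      ∫⁻ x, h x * g x ∂ν ≤ C * (∫⁻ x, g x ^ (q / (q - 1)) ∂ν) ^ (1 / (q / (q - 1)))) :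
    (∫⁻ x, h x ^ q ∂ν) ^ (1 / q) ≤ C := by
  have hq0 : 0 < q := by linarith
  have hq1 : 0 < q - 1 := by linarith
  let hm : ℕ → X → ℝ≥0∞ := fun i => (B i).indicator fun x => min (h x) i
  have hmm : ∀ i, Measurable (hm i) := fun i => (hh.min measurable_const).indicator (hB i)
  have hle : ∀ i x, hm i x ≤ h x := fun i x => by
    by_cases hx : x ∈ B i <;> simp [hm, hx]
  have key : ∀ i, ∫⁻ x, hm i x ^ q ∂ν ≤ C ^ q := fun i => by
    refine absorb hq0 ?_ ?_
    · refine ne_top_of_le_ne_top (b := ∫⁻ x in B i, (i : ℝ≥0∞) ^ q ∂ν) ?_ ?_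
      · rw [setLIntegral_const]
        exact ENNReal.mul_ne_top (by simp [hq0.le]) (hfin i)
      · rw [← lintegral_indicator (hB i)]
        refine lintegral_mono fun x => ?_
        by_cases hx : x ∈ B i
        · simp only [hm, hx, indicator_of_mem]
          gcongr; exact min_le_right _ _
        · simp [hm, hx, hq0]
    · calc ∫⁻ x, hm i x ^ q ∂ν ≤ ∫⁻ x, h x * hm i x ^ (q - 1) ∂ν := by
            refine lintegral_mono fun x => ?_
            have : hm i x ^ q = hm i x * hm i x ^ (q - 1) := by
              conv_rhs => rw [← ENNReal.rpow_one (hm i x), ← ENNReal.rpow_mul]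
              rw [← ENNReal.rpow_add_of_nonneg _ _ (by norm_num) (by linarith)]
              congr 1; ring
            simp only []
            rw [this]; gcongr; exact hle i x
        _ ≤ _ := H _ ((hmm i).pow_const _)
        _ = _ := by
            simp_rw [← ENNReal.rpow_mul]
            have e1 : (q - 1) * (q / (q - 1)) = q := by field_simp
            have e2 : 1 / (q / (q - 1)) = 1 - 1 / q := by field_simp
            rw [e1, e2]
  have hmon : Monotone fun i x => hm i x ^ q := by
    intro i j hij x
    simp only []
    gcongr
    by_cases hx : x ∈ B i
    · have hx' := hmono hij hx
      simp only [hm, hx, hx', indicator_of_mem]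
      gcongr
    · simp [hm, hx]
  have hsup : ∀ x, h x ^ q = ⨆ i, hm i x ^ q := fun x => by
    refine le_antisymm ?_ (iSup_le fun i => by gcongr; exact hle i x)
    obtain ⟨i0, hi0⟩ := mem_iUnion.1 (hU ▸ mem_univ x : x ∈ ⋃ i, B i)
    refine le_of_forall_lt fun c hc => ?_
    have hc' : c ^ (1 / q) < h x := by
      have := ENNReal.rpow_lt_rpow hc (by positivity : 0 < 1 / q)
      rwa [← ENNReal.rpow_mul, mul_one_div_cancel hq0.ne', ENNReal.rpow_one] at this
    obtain ⟨m, hm1⟩ := ENNReal.exists_nat_gt (hc'.ne_top)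
    refine lt_of_lt_of_le ?_ (le_iSup _ (max i0 m))
    have hx : x ∈ B (max i0 m) := hmono (le_max_left _ _) hi0
    simp only [hm, hx, indicator_of_mem]
    have h3 : c ^ (1 / q) < min (h x) ((max i0 m : ℕ) : ℝ≥0∞) := by
      refine lt_min hc' (hm1.trans_le ?_)
      exact_mod_cast le_max_right _ _
    have := ENNReal.rpow_lt_rpow h3 hq0
    rwa [← ENNReal.rpow_mul, one_div_mul_cancel hq0.ne', ENNReal.rpow_one] at this
  have : ∫⁻ x, h x ^ q ∂ν ≤ C ^ q := by
    simp_rw [hsup]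
    rw [lintegral_iSup (fun i => (hmm i).pow_const q) hmon]
    exact iSup_le key
  calc _ ≤ (C ^ q) ^ (1 / q) := by gcongr
    _ = C := by rw [← ENNReal.rpow_mul, mul_one_div_cancel hq0.ne', ENNReal.rpow_one]

end Abstract

/-- shifts of the dyadic grids -/
def gshift (b : Bool) (k : ℤ) : ℝ := if b then (if Even k then 1 / 3 else 2 / 3) else 0

/-- index of the dyadic cube of side `2^k` of the shifted grid `t` -/
def gp {n : ℕ} (t : Fin n → Bool) (k : ℤ) (x : Euc n) : Fin n → ℤ :=
  fun i => ⌊x i * (2 : ℝ) ^ (-k) + gshift (t i) k⌋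

lemma gp_meas {n : ℕ} (t : Fin n → Bool) (k : ℤ) : Measurable (gp t k) := by
  refine measurable_pi_lambda _ fun i => Int.measurable_floor.comp ?_
  fun_prop

lemma gshift_step (b : Bool) (k : ℤ) : ∃ m : ℤ, 2 * gshift b (k + 1) = gshift b k + m := by
  unfold gshift
  cases b
  · exact ⟨0, by simp⟩
  · by_cases h : Even k
    · refine ⟨1, ?_⟩
      have : ¬ Even (k + 1) := by simp [Int.even_add_one, h]
      simp [h, this]; norm_num
    · refine ⟨0, ?_⟩
      have : Even (k + 1) := Int.even_add_one.2 h
      simp only [h, this, if_true, if_false]; norm_num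

lemma floor_half (z z' : ℝ) (h : ⌊z⌋ = ⌊z'⌋) (m : ℤ) : ⌊(z + m) / 2⌋ = ⌊(z' + m) / 2⌋ := by
  have key : ∀ y : ℝ, ⌊(y + m) / 2⌋ = (⌊y⌋ + m) / 2 := fun y => by
    have h1 := Int.floor_le y
    have h2 := Int.lt_floor_add_one y
    have h3 : 2 * ((⌊y⌋ + m) / 2) ≤ ⌊y⌋ + m := by omega
    have h4 : ⌊y⌋ + m + 1 ≤ 2 * ((⌊y⌋ + m) / 2) + 2 := by omega
    have h3' : 2 * (((⌊y⌋ + m) / 2 : ℤ) : ℝ) ≤ ⌊y⌋ + m := by exact_mod_cast h3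
    have h4' : (⌊y⌋ : ℝ) + m + 1 ≤ 2 * (((⌊y⌋ + m) / 2 : ℤ) : ℝ) + 2 := by exact_mod_cast h4
    rw [Int.floor_eq_iff]
    constructor <;> linarith
  rw [key, key, h]

lemma gp_nest {n : ℕ} (t : Fin n → Bool) (k : ℤ) (x y : Euc n) (h : gp t k x = gp t k y) :
    gp t (k + 1) x = gp t (k + 1) y := by
  funext i
  have hi := congrFun h i
  obtain ⟨m, hm⟩ := gshift_step (t i) k
  have e : ∀ z : ℝ, z * (2 : ℝ) ^ (-(k + 1)) + gshift (t i) (k + 1) =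
      (z * (2 : ℝ) ^ (-k) + gshift (t i) k + m) / 2 := fun z => by
    have : (2 : ℝ) ^ (-(k + 1)) = 2 ^ (-k) / 2 := by
      rw [neg_add, ← sub_eq_add_neg, zpow_sub_one₀ (by norm_num)]; rfl
    rw [this]; linarith
  simp only [gp] at hi ⊢
  rw [e, e]
  exact floor_half _ _ hi m

/-- lower corner -/
def gcorner {n : ℕ} (t : Fin n → Bool) (k : ℤ) (x : Euc n) : Fin n → ℝ :=
  fun i => ((gp t k x i : ℝ) - gshift (t i) k) * 2 ^ k

lemma gdq_eq {n : ℕ} (t : Fin n → Bool) (k : ℤ) (x : Euc n) :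
    dq (gp t) k x = (MeasurableEquiv.toLp 2 (Fin n → ℝ)).symm ⁻¹'
      (Set.pi univ fun i => Ico (gcorner t k x i) (gcorner t k x i + 2 ^ k)) := by
  ext y
  have h2 : (0 : ℝ) < 2 ^ k := by positivity
  have hz : (2 : ℝ) ^ (-k) = (2 ^ k)⁻¹ := zpow_neg _ _
  simp only [dq, mem_preimage, mem_singleton_iff, mem_pi, mem_univ, forall_true_left, mem_Ico,
    funext_iff]
  refine forall_congr' fun i => ?_
  have : (MeasurableEquiv.toLp 2 (Fin n → ℝ)).symm y i = y i := rfl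
  rw [this]
  conv_lhs => lhs; unfold gp
  rw [Int.floor_eq_iff, hz]
  unfold gcorner
  constructor
  · rintro ⟨h, h'⟩
    constructor
    · have := mul_le_mul_of_nonneg_right (sub_le_iff_le_add.2 h) h2.le
      rwa [mul_assoc, inv_mul_cancel₀ h2.ne', mul_one] at this
    · have := mul_lt_mul_of_pos_right (lt_sub_iff_add_lt.2 h') h2
      rw [mul_assoc, inv_mul_cancel₀ h2.ne', mul_one] at this
      linarith
  · rintro ⟨h, h'⟩
    have hy : y i = y i * (2 ^ k)⁻¹ * 2 ^ k := by
      rw [mul_assoc, inv_mul_cancel₀ h2.ne', mul_one]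
    rw [hy] at h h'
    constructor
    · have := le_of_mul_le_mul_right h h2
      linarith
    · have h'' : y i * (2 ^ k)⁻¹ * 2 ^ k < ((gp t k x i : ℝ) - gshift (t i) k + 1) * 2 ^ k := by
        linarith
      have := lt_of_mul_lt_mul_right h'' h2.le
      linarith

lemma two_zpow_pow (n : ℕ) (k : ℤ) :
    ∏ _i : Fin n, ENNReal.ofReal ((2 : ℝ) ^ k) = 2 ^ ((k : ℝ) * n) := by
  rw [Finset.prod_const, Finset.card_univ, Fintype.card_fin]
  rw [ENNReal.rpow_mul, ENNReal.rpow_natCast, ← Real.rpow_intCast,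
    ← ENNReal.ofReal_rpow_of_pos (by norm_num)]
  simp

lemma gdq_vol {n : ℕ} (t : Fin n → Bool) (k : ℤ) (x : Euc n) :
    volume (dq (gp t) k x) = 2 ^ ((k : ℝ) * n) := by
  rw [gdq_eq, (EuclideanSpace.volume_preserving_symm_measurableEquiv_toLp (Fin n)).measure_preimage
    (MeasurableSet.univ_pi fun i => measurableSet_Ico).nullMeasurableSet, Real.volume_pi_Ico,
    ← two_zpow_pow]
  simp

lemma cube_eq {n : ℕ} (a : Euc n) (h : ℝ) :
    Cube a h = (MeasurableEquiv.toLp 2 (Fin n → ℝ)).symm ⁻¹'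
      (Set.pi univ fun i => Icc (a i) (a i + h)) := by
  ext y
  simp only [Cube, mem_preimage, mem_pi, mem_univ, forall_true_left, mem_Icc]
  rfl

lemma cube_meas {n : ℕ} (a : Euc n) (h : ℝ) : MeasurableSet (Cube a h) := by
  rw [cube_eq]
  exact (MeasurableEquiv.measurable _) (MeasurableSet.univ_pi fun i => measurableSet_Icc)

lemma cube_vol {n : ℕ} (a : Euc n) (h : ℝ) : volume (Cube a h) = ENNReal.ofReal h ^ n := by
  rw [cube_eq, (EuclideanSpace.volume_preserving_symm_measurableEquiv_toLp (Fin n)).measure_preimage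
    (MeasurableSet.univ_pi fun i => measurableSet_Icc).nullMeasurableSet, volume_pi_pi]
  simp

lemma gdq_sub {n : ℕ} (t : Fin n → Bool) (k : ℤ) (x : Euc n) :
    dq (gp t) k x ⊆ Cube (WithLp.toLp 2 (gcorner t k x)) (2 ^ k) := by
  rw [gdq_eq, cube_eq]
  refine preimage_mono (pi_mono fun i _ => Ico_subset_Icc_self)

lemma cube_vol2 {n : ℕ} (a : Euc n) (k : ℤ) :
    volume (Cube a (2 ^ k)) = 2 ^ ((k : ℝ) * n) := by
  rw [cube_vol, ← two_zpow_pow]; simp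

lemma third (k : ℤ) (a b : ℝ) (h : |a - b| < 1 / 3) :
    ∃ c : Bool, ⌊a + gshift c k⌋ = ⌊b + gshift c k⌋ := by
  by_cases h0 : ⌊a⌋ = ⌊b⌋
  · exact ⟨false, by simpa [gshift] using h0⟩
  refine ⟨true, ?_⟩
  have main : ∀ a b : ℝ, |a - b| < 1 / 3 → ⌊a⌋ < ⌊b⌋ → ⌊a + gshift true k⌋ = ⌊b + gshift true k⌋ := by
    intro a b h hlt
    have h1 : a < ⌊b⌋ := by
      have := Int.lt_floor_add_one a
      have h2 : (⌊a⌋ : ℝ) + 1 ≤ ⌊b⌋ := by exact_mod_cast hlt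
      linarith
    have h2 := Int.floor_le b
    rw [abs_lt] at h
    have hs : gshift true k = 1 / 3 ∨ gshift true k = 2 / 3 := by
      unfold gshift; by_cases he : Even k <;> simp [he]
    have e1 : ⌊a + gshift true k⌋ = ⌊b⌋ := by
      rw [Int.floor_eq_iff]; rcases hs with hs | hs <;> rw [hs] <;> constructor <;> linarith
    have e2 : ⌊b + gshift true k⌋ = ⌊b⌋ := by
      rw [Int.floor_eq_iff]; rcases hs with hs | hs <;> rw [hs] <;> constructor <;> linarith
    rw [e1, e2]
  rcases lt_or_gt_of_ne h0 with h1 | h1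
  · exact main a b h h1
  · exact (main b a (by rwa [abs_sub_comm]) h1).symm

lemma kernel_bound {n : ℕ} (α : ℝ) (hαn : α < n) (x y : Euc n) :
    ENNReal.ofReal (‖x - y‖ ^ (α - (n : ℝ))) ≤ ENNReal.ofReal (6 ^ ((n : ℝ) - α)) *
      ∑ t : Fin n → Bool, ∑' k : ℤ, 2 ^ (k * (α - n)) * (dq (gp t) k x).indicator 1 y := by
  have hneg : α - (n : ℝ) < 0 := by linarith
  rcases eq_or_ne x y with h | h
  · subst h
    simp [Real.zero_rpow hneg.ne]
  have hpos : 0 < ‖x - y‖ := norm_pos_iff.2 (sub_ne_zero.2 h)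
  obtain ⟨k, hk1, hk2⟩ := _root_.exists_mem_Ico_zpow (x := 3 * ‖x - y‖) (y := (2 : ℝ))
    (by positivity) (by norm_num)
  have h2 : (0 : ℝ) < 2 ^ (k + 1) := by positivity
  have hco : ∀ i, ∃ c : Bool, ⌊x i * (2 : ℝ) ^ (-(k + 1)) + gshift c (k + 1)⌋ =
      ⌊y i * (2 : ℝ) ^ (-(k + 1)) + gshift c (k + 1)⌋ := fun i => by
    refine third (k + 1) _ _ ?_
    rw [← sub_mul, abs_mul, zpow_neg, abs_of_pos (inv_pos.2 h2), ← div_eq_mul_inv,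
      div_lt_iff₀ h2]
    have := PiLp.norm_apply_le (x - y) i
    simp only [PiLp.sub_apply, Real.norm_eq_abs] at this
    linarith
  choose t ht using hco
  have hmem : y ∈ dq (gp t) (k + 1) x := by
    simp only [dq, mem_preimage, mem_singleton_iff]
    funext i
    exact (ht i).symm
  calc ENNReal.ofReal (‖x - y‖ ^ (α - (n : ℝ)))
      ≤ ENNReal.ofReal (6 ^ ((n : ℝ) - α) * (2 : ℝ) ^ (((k + 1 : ℤ) : ℝ) * (α - n))) := by
        refine ENNReal.ofReal_le_ofReal ?_
        have e1 : (6 : ℝ) ^ ((n : ℝ) - α) * (2 : ℝ) ^ (((k + 1 : ℤ) : ℝ) * (α - n)) =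
            (2 ^ (k + 1) / 6 : ℝ) ^ (α - n) := by
          rw [Real.div_rpow (by positivity) (by norm_num), Real.rpow_mul (by norm_num),
            Real.rpow_intCast]
          have : (6 : ℝ) ^ (α - n) = (6 ^ ((n : ℝ) - α))⁻¹ := by
            rw [← Real.rpow_neg (by norm_num)]; congr 1; ring
          rw [this]; field_simp
        rw [e1]
        refine Real.rpow_le_rpow_of_nonpos (by positivity) ?_ hneg.le
        rw [zpow_add_one₀ (by norm_num)]
        linarith
    _ = ENNReal.ofReal (6 ^ ((n : ℝ) - α)) * (2 ^ (((k + 1 : ℤ) : ℝ) * (α - n)) *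
          (dq (gp t) (k + 1) x).indicator 1 y) := by
        have e2 : ENNReal.ofReal ((2 : ℝ) ^ (((k + 1 : ℤ) : ℝ) * (α - n))) =
            2 ^ (((k + 1 : ℤ) : ℝ) * (α - n)) := by
          rw [← ENNReal.ofReal_rpow_of_pos (by norm_num)]; simp
        rw [ENNReal.ofReal_mul (by positivity), e2, indicator_of_mem hmem]
        simp
    _ ≤ _ := by
        gcongr
        refine le_trans ?_ (Finset.single_le_sum (f := fun t : Fin n → Bool =>
          ∑' k : ℤ, (2 : ℝ≥0∞) ^ (k * (α - n)) * (dq (gp t) k x).indicator 1 y)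
          (fun _ _ => zero_le) (Finset.mem_univ t))
        exact ENNReal.le_tsum (f := fun k : ℤ => (2 : ℝ≥0∞) ^ (k * (α - n)) *
          (dq (gp t) k x).indicator 1 y) (k + 1)

lemma riesz_le {n : ℕ} (α : ℝ) (hαn : α < n) (f : Euc n → ℝ) (hf : Measurable f) (x : Euc n) :
    riesz α f x ≤ ENNReal.ofReal (6 ^ ((n : ℝ) - α)) *
      ∑ t : Fin n → Bool, ∑' k : ℤ, 2 ^ (k * (α - n)) *
        ∫⁻ y in dq (gp t) k x, ENNReal.ofReal |f y| := by
  have hfm : Measurable fun y => ENNReal.ofReal |f y| := by fun_prop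
  have hdm : ∀ (t : Fin n → Bool) (k : ℤ), MeasurableSet (dq (gp t) k x) := fun t k =>
    dq_meas (gp_meas t) k x
  have him : ∀ (t : Fin n → Bool) (k : ℤ), Measurable fun y =>
      (2 : ℝ≥0∞) ^ (k * (α - n)) * ((dq (gp t) k x).indicator 1 y * ENNReal.ofReal |f y|) :=
    fun t k => ((measurable_one.indicator (hdm t k)).fun_mul hfm).const_mul _
  calc riesz α f x ≤ ∫⁻ y, ENNReal.ofReal (6 ^ ((n : ℝ) - α)) *
      ∑ t : Fin n → Bool, ∑' k : ℤ, 2 ^ (k * (α - n)) *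
        ((dq (gp t) k x).indicator 1 y * ENNReal.ofReal |f y|) := by
        refine lintegral_mono fun y => ?_
        refine (mul_le_mul_right (kernel_bound α hαn x y) _).trans (le_of_eq ?_)
        rw [mul_comm, mul_assoc, Finset.sum_mul]
        simp_rw [← ENNReal.tsum_mul_right, mul_assoc]
    _ = _ := by
        rw [lintegral_const_mul _ (Finset.measurable_fun_sum _ fun t _ =>
          Measurable.ennreal_tsum (him t)),
          lintegral_finsetSum _ fun t _ => Measurable.ennreal_tsum (him t)]
        congr 1
        refine Finset.sum_congr rfl fun t _ => ?_
        rw [lintegral_tsum fun k => (him t k).aemeasurable]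
        refine tsum_congr fun k => ?_
        rw [lintegral_const_mul _ ((measurable_one.indicator (hdm t k)).fun_mul hfm),
          ← lintegral_indicator (hdm t k)]
        congr 2
        funext y
        by_cases hy : y ∈ dq (gp t) k x <;> simp [hy]

/-- exhausting cubes -/
def bigC (n : ℕ) (i : ℕ) : Set (Euc n) :=
  Cube (WithLp.toLp 2 fun _ => -((i : ℝ) + 1)) (2 * ((i : ℝ) + 1))

lemma bigC_mem {n : ℕ} (i : ℕ) (x : Euc n) : x ∈ bigC n i ↔ ∀ j, |x j| ≤ (i : ℝ) + 1 := by
  unfold bigC Cube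
  simp only [Set.mem_setOf_eq]
  refine forall_congr' fun j => ?_
  rw [abs_le]
  constructor
  · rintro ⟨h1, h2⟩; exact ⟨h1, by linarith⟩
  · rintro ⟨h1, h2⟩; exact ⟨h1, by linarith⟩

lemma bigC_mono (n : ℕ) : Monotone (bigC n) := by
  intro i j hij x hx
  rw [bigC_mem] at hx ⊢
  intro l
  have : (i : ℝ) ≤ j := by exact_mod_cast hij
  linarith [hx l]

lemma bigC_union (n : ℕ) : ⋃ i, bigC n i = univ := by
  refine eq_univ_of_forall fun x => mem_iUnion.2 ?_
  obtain ⟨i, hi⟩ := exists_nat_ge ‖x‖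
  refine ⟨i, (bigC_mem i x).2 fun j => ?_⟩
  have := PiLp.norm_apply_le x j
  rw [Real.norm_eq_abs] at this
  linarith

lemma apq_cube {n : ℕ} {p q : ℝ} (hp : 1 < p) {δ : ℝ} (hδ1 : δ < 1)
    (hpq' : q / dualExp p = 1 - δ) (w : Euc n → ℝ) (a : Euc n) (h : ℝ) (hh : 0 < h) :
    (∫⁻ x in Cube a h, ENNReal.ofReal (w x) ^ q) *
      (∫⁻ x in Cube a h, ENNReal.ofReal (w x) ^ (-(dualExp p))) ^ (1 - δ) ≤
      Apq p q w * volume (Cube a h) ^ (2 - δ) := by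
  have h0 : volume (Cube a h) ≠ 0 := by
    rw [cube_vol]; exact pow_ne_zero _ (by simpa using hh)
  have ht : volume (Cube a h) ≠ ∞ := by rw [cube_vol]; simp
  set V := volume (Cube a h)
  set U := ∫⁻ x in Cube a h, ENNReal.ofReal (w x) ^ q
  set S := ∫⁻ x in Cube a h, ENNReal.ofReal (w x) ^ (-(dualExp p))
  have key : (V⁻¹ * U) * (V⁻¹ * S) ^ (1 - δ) ≤ Apq p q w := by
    unfold Apq
    refine le_trans ?_ (le_iSup_of_le a (le_iSup_of_le h (le_iSup_of_le hh le_rfl)))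
    rw [if_neg hp.ne', hpq']
  have e : V⁻¹ * V⁻¹ ^ (1 - δ) * V ^ (2 - δ) = 1 := by
    rw [← ENNReal.rpow_neg_one, ← ENNReal.rpow_mul, ← ENNReal.rpow_add _ _ h0 ht,
      ← ENNReal.rpow_add _ _ h0 ht]
    have : -1 + -1 * (1 - δ) + (2 - δ) = 0 := by ring
    rw [this, ENNReal.rpow_zero]
  calc U * S ^ (1 - δ) = (V⁻¹ * V⁻¹ ^ (1 - δ) * V ^ (2 - δ)) * (U * S ^ (1 - δ)) := by
        rw [e, one_mul]
    _ = ((V⁻¹ * U) * (V⁻¹ * S) ^ (1 - δ)) * V ^ (2 - δ) := by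
        rw [ENNReal.mul_rpow_of_nonneg _ _ (by linarith)]; ring
    _ ≤ _ := by gcongr

lemma setlint_ne_zero {n : ℕ} {s : Euc n → ℝ≥0∞} (hs : Measurable s) (h : ∀ᵐ x, s x ≠ 0)
    {E : Set (Euc n)} (hE : volume E ≠ 0) : ∫⁻ x in E, s x ≠ 0 := by
  intro h0
  rw [lintegral_eq_zero_iff hs] at h0
  have h1 : ∀ᵐ x ∂(volume.restrict E), s x ≠ 0 := ae_restrict_of_ae h
  have : ∀ᵐ x ∂(volume.restrict E), False := by
    filter_upwards [h0, h1] with x a b using b a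
  rw [Filter.eventually_false_iff_eq_bot, ae_eq_bot, Measure.restrict_eq_zero] at this
  exact hE this

lemma core {n : ℕ} (hn : 0 < n) (α : ℝ) (hα : 0 < α) (hαn : α < n) (p q : ℝ) (hp : 1 < p)
    (hq : 1 < q) (hpq : 1 / q = 1 / p - α / n) (hpq' : q / dualExp p = 1 - α / n)
    (hqq : q * (q - 1) = dualExp p) (w f : Euc n → ℝ) (hw : Measurable w) (hf : Measurable f)
    (hpos : ∀ᵐ x, 0 < w x) (hA : Apq p q w ≠ ∞) :
    wLpE w (riesz α f) q ≤ ENNReal.ofReal (6 ^ ((n : ℝ) - α)) *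
      ((Fintype.card (Fin n → Bool) : ℝ≥0∞) * (bC (α / 2) p q * Apq p q w * wLp w f p)) := by
  have hn0 : (0 : ℝ) < n := by exact_mod_cast hn
  have hδ : 0 < α / n := by positivity
  have hδ1 : α / n < 1 := by rwa [div_lt_one hn0]
  have hδn : α / n * n = α := by field_simp
  have hd : 0 < dualExp p := by unfold dualExp; exact div_pos (by linarith) (by linarith)
  have hq0 : 0 < q := by linarith
  have hp0 : 0 < p := by linarith
  set P := dualExp p with hP
  set s : Euc n → ℝ≥0∞ := fun x => ENNReal.ofReal (w x) ^ (-P) with hs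
  set u : Euc n → ℝ≥0∞ := fun x => ENNReal.ofReal (w x) ^ q with hu
  have hsm : Measurable s := hw.ennreal_ofReal.pow_const _
  have hum : Measurable u := hw.ennreal_ofReal.pow_const _
  have hs_ae : ∀ᵐ x, s x ≠ 0 := by
    filter_upwards [hpos] with x hx
    exact (ENNReal.rpow_pos (by simpa using hx) ENNReal.ofReal_ne_top).ne'
  have hu_ae : ∀ᵐ x, u x ≠ 0 := by
    filter_upwards [hpos] with x hx
    exact (ENNReal.rpow_pos (by simpa using hx) ENNReal.ofReal_ne_top).ne'
  have hcv : ∀ (a : Euc n) (h : ℝ), 0 < h → volume (Cube a h) ≠ 0 := fun a h hh => by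
    rw [cube_vol]; exact pow_ne_zero _ (by simpa using hh)
  have hcvt : ∀ (a : Euc n) (h : ℝ), volume (Cube a h) ≠ ∞ := fun a h => by
    rw [cube_vol]; simp
  have hfin : ∀ (a : Euc n) (h : ℝ), 0 < h →
      ∫⁻ x in Cube a h, u x ≠ ∞ ∧ ∫⁻ x in Cube a h, s x ≠ ∞ := fun a h hh => by
    have hc := apq_cube hp hδ1 hpq' w a h hh
    have hb : Apq p q w * volume (Cube a h) ^ (2 - α / n) ≠ ∞ :=
      ENNReal.mul_ne_top hA (ENNReal.rpow_ne_top_of_nonneg (by linarith) (hcvt a h))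
    have hU0 := setlint_ne_zero hum hu_ae (hcv a h hh)
    have hS0 := setlint_ne_zero hsm hs_ae (hcv a h hh)
    have hne := ne_top_of_le_ne_top hb hc
    constructor
    · intro hU
      rw [show (∫⁻ x in Cube a h, ENNReal.ofReal (w x) ^ q) = ∞ from hU] at hne
      refine hne (ENNReal.top_mul ?_)
      intro hz
      rw [ENNReal.rpow_eq_zero_iff_of_pos (by linarith)] at hz
      exact hS0 hz
    · intro hS
      rw [show (∫⁻ x in Cube a h, ENNReal.ofReal (w x) ^ (-(dualExp p))) = ∞ from hS,
        ENNReal.top_rpow_of_pos (by linarith)] at hne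
      exact hne (ENNReal.mul_top hU0)
  have h2k : ∀ k : ℤ, (0 : ℝ) < 2 ^ k := fun k => by positivity
  have hdm : ∀ (t : Fin n → Bool) (k : ℤ) (x : Euc n), MeasurableSet (dq (gp t) k x) :=
    fun t k x => dq_meas (gp_meas t) k x
  have hdv : ∀ (t : Fin n → Bool) (k : ℤ) (x : Euc n), volume (dq (gp t) k x) ≠ 0 :=
    fun t k x => by
      rw [gdq_vol]; exact (ENNReal.rpow_pos (by norm_num) (by norm_num)).ne'
  set F : Euc n → ℝ≥0∞ := fun x => ENNReal.ofReal |f x| with hF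
  have hFm : Measurable F := by rw [hF]; fun_prop
  set f' : Euc n → ℝ≥0∞ := fun x => F x * ENNReal.ofReal (w x) ^ P with hf'
  have hf'm : Measurable f' := hFm.mul (hw.ennreal_ofReal.pow_const _)
  have hsf : ∀ᵐ x, s x * f' x = F x := by
    filter_upwards [hpos] with x hx
    have ha0 : ENNReal.ofReal (w x) ≠ 0 := by simpa using hx
    have hat : ENNReal.ofReal (w x) ≠ ∞ := ENNReal.ofReal_ne_top
    simp only [hs, hf']
    rw [mul_left_comm, ← ENNReal.rpow_add _ _ ha0 hat]; simp
  have hsfp : ∫⁻ x, s x * f' x ^ p = ∫⁻ x, (ENNReal.ofReal (w x) * ENNReal.ofReal |f x|) ^ p := by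
    refine lintegral_congr_ae ?_
    filter_upwards [hpos] with x hx
    have ha0 : ENNReal.ofReal (w x) ≠ 0 := by simpa using hx
    have hat : ENNReal.ofReal (w x) ≠ ∞ := ENNReal.ofReal_ne_top
    simp only [hs, hf', hF]
    rw [ENNReal.mul_rpow_of_nonneg _ _ hp0.le, ENNReal.mul_rpow_of_nonneg _ _ hp0.le,
      mul_left_comm, ← ENNReal.rpow_mul, ← ENNReal.rpow_add _ _ ha0 hat, mul_comm]
    congr 2
    rw [hP, dualExp]
    have : p - 1 ≠ 0 := by linarith
    field_simp; ring
  have he : ∀ᵐ x, s x ^ (1 / q) * u x ^ (1 / (q / (q - 1))) = 1 := by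
    filter_upwards [hpos] with x hx
    have ha0 : ENNReal.ofReal (w x) ≠ 0 := by simpa using hx
    have hat : ENNReal.ofReal (w x) ≠ ∞ := ENNReal.ofReal_ne_top
    simp only [hs, hu]
    rw [← ENNReal.rpow_mul, ← ENNReal.rpow_mul, ← ENNReal.rpow_add _ _ ha0 hat, ← hqq]
    have : -(q * (q - 1)) * (1 / q) + q * (1 / (q / (q - 1))) = 0 := by
      have : q - 1 ≠ 0 := by linarith
      field_simp; ring
    rw [this, ENNReal.rpow_zero]
  have bil : ∀ (t : Fin n → Bool) (g : Euc n → ℝ≥0∞) (_ : Measurable g) (K : Finset ℤ),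
      ∑ k ∈ K, ∫⁻ x, (2 ^ (k * (α - n)) * ∫⁻ y in dq (gp t) k x, F y) * (u x * g x) ≤
      bC (α / 2) p q * Apq p q w * wLp w f p *
        (∫⁻ x, u x * g x ^ (q / (q - 1))) ^ (1 / (q / (q - 1))) := by
    intro t g hg K
    have hwd : ∀ (v : Euc n → ℝ≥0∞) (k : ℤ) (x : Euc n),
        (volume.withDensity v) (dq (gp t) k x) = ∫⁻ y in dq (gp t) k x, v y := fun v k x =>
      withDensity_apply _ (hdm t k x)
    have B := bilinear (gp_meas t) (gp_nest t) volume n (α / n) (gdq_vol t) hδ s u hsm hum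
      (fun k x => by rw [hwd]; exact setlint_ne_zero hsm hs_ae (hdv t k x))
      (fun k x => by
        rw [hwd]
        exact ne_top_of_le_ne_top (hfin _ _ (h2k k)).2 (lintegral_mono_set (gdq_sub t k x)))
      (fun k x => by rw [hwd]; exact setlint_ne_zero hum hu_ae (hdv t k x))
      (fun k x => by
        rw [hwd]
        exact ne_top_of_le_ne_top (hfin _ _ (h2k k)).1 (lintegral_mono_set (gdq_sub t k x)))
      (Apq p q w)
      (fun k x => by
        rw [hwd, hwd, gdq_vol, ← cube_vol2 (WithLp.toLp 2 (gcorner t k x)) k]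
        refine le_trans ?_ (apq_cube hp hδ1 hpq' w _ _ (h2k k))
        refine mul_le_mul' (lintegral_mono_set (gdq_sub t k x)) ?_
        exact ENNReal.rpow_le_rpow (lintegral_mono_set (gdq_sub t k x)) (by linarith))
      p q hp hq hpq he f' g hf'm hg K
    rw [hδn, hsfp] at B
    refine le_trans (le_of_eq ?_) B
    refine Finset.sum_congr rfl fun k _ => lintegral_congr fun x => ?_
    congr 2
    exact lintegral_congr_ae (ae_restrict_of_ae (hsf.mono fun y hy => hy.symm))
  have htm : ∀ (t : Fin n → Bool) (k : ℤ), Measurable fun x : Euc n =>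
      (2 : ℝ≥0∞) ^ ((k : ℝ) * (α - n)) * ∫⁻ y in dq (gp t) k x, F y := fun t k =>
    meas_of_level (gp_meas t) k _ fun x y h => by rw [dq_congr h]
  set H : Euc n → ℝ≥0∞ := fun x => ∑ t : Fin n → Bool, ∑' k : ℤ,
    2 ^ ((k : ℝ) * (α - n)) * ∫⁻ y in dq (gp t) k x, F y with hH
  have hHm : Measurable H :=
    Finset.measurable_fun_sum _ fun t _ => Measurable.ennreal_tsum (htm t)
  have hdual : (∫⁻ x, H x ^ q ∂(volume.withDensity u)) ^ (1 / q) ≤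
      (Fintype.card (Fin n → Bool) : ℝ≥0∞) * (bC (α / 2) p q * Apq p q w * wLp w f p) := by
    refine dual_test _ H hHm hq (bigC n) (fun i => cube_meas _ _) (bigC_mono n) (bigC_union n)
      (fun i => ?_) _ fun g hg => ?_
    · rw [bigC, withDensity_apply _ (cube_meas _ _)]
      exact (hfin _ _ (by positivity)).1
    · have hm1 : ∀ (t : Fin n → Bool) (k : ℤ), Measurable fun x : Euc n =>
          ((2 : ℝ≥0∞) ^ ((k : ℝ) * (α - n)) * ∫⁻ y in dq (gp t) k x, F y) * (u x * g x) :=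
        fun t k => (htm t k).fun_mul (hum.fun_mul hg)
      rw [lintegral_withDensity_eq_lintegral_mul _ hum (hHm.fun_mul hg),
        lintegral_withDensity_eq_lintegral_mul _ hum (hg.pow_const _)]
      calc _ = ∫⁻ x, ∑ t : Fin n → Bool, ∑' k : ℤ,
            (2 ^ ((k : ℝ) * (α - n)) * ∫⁻ y in dq (gp t) k x, F y) * (u x * g x) := by
            refine lintegral_congr fun x => ?_
            simp only [Pi.mul_apply, hH]
            simp_rw [ENNReal.tsum_mul_right]
            rw [← Finset.sum_mul]; ring
        _ = ∑ t : Fin n → Bool, ∑' k : ℤ, ∫⁻ x,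
            (2 ^ ((k : ℝ) * (α - n)) * ∫⁻ y in dq (gp t) k x, F y) * (u x * g x) := by
            rw [lintegral_finsetSum _ fun t _ => Measurable.ennreal_tsum (hm1 t)]
            refine Finset.sum_congr rfl fun t _ => ?_
            rw [lintegral_tsum fun k => (hm1 t k).aemeasurable]
        _ ≤ ∑ _t : Fin n → Bool, bC (α / 2) p q * Apq p q w * wLp w f p *
            (∫⁻ x, u x * g x ^ (q / (q - 1))) ^ (1 / (q / (q - 1))) := by
            refine Finset.sum_le_sum fun t _ => ?_
            rw [ENNReal.tsum_eq_iSup_sum]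
            exact iSup_le fun K => bil t g hg K
        _ = _ := by
            rw [Finset.sum_const, Finset.card_univ, nsmul_eq_mul]
            simp only [Pi.mul_apply]
            ring
  set C6 := ENNReal.ofReal (6 ^ ((n : ℝ) - α)) with hC6
  calc wLpE w (riesz α f) q ≤ (∫⁻ x, C6 ^ q * (u x * H x ^ q)) ^ (1 / q) := by
        unfold wLpE
        gcongr with x
        calc (ENNReal.ofReal (w x) * riesz α f x) ^ q ≤ (ENNReal.ofReal (w x) * (C6 * H x)) ^ q := by
              gcongr; exact riesz_le α hαn f hf x
          _ = _ := by
              rw [ENNReal.mul_rpow_of_nonneg _ _ hq0.le, ENNReal.mul_rpow_of_nonneg _ _ hq0.le]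
              simp only [hu]; ring
    _ = C6 * (∫⁻ x, H x ^ q ∂(volume.withDensity u)) ^ (1 / q) := by
        rw [lintegral_const_mul _ (hum.fun_mul (hHm.pow_const q)),
          ENNReal.mul_rpow_of_nonneg _ _ (by positivity), ← ENNReal.rpow_mul,
          mul_one_div_cancel hq0.ne', ENNReal.rpow_one,
          lintegral_withDensity_eq_lintegral_mul _ hum (hHm.pow_const q)]
        rfl
    _ ≤ _ := by gcongr

lemma pos_ae {n : ℕ} {p q : ℝ} (hp : 1 < p) (hq : 0 < q) {δ : ℝ} (hδ1 : δ < 1)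
    (hpq' : q / dualExp p = 1 - δ) (w : Euc n → ℝ) (hw : Measurable w)
    (hA : Apq p q w ≠ ∞) (hnz : ¬ ∀ᵐ x, ENNReal.ofReal (w x) = 0) : ∀ᵐ x, 0 < w x := by
  have hd : 0 < dualExp p := by unfold dualExp; exact div_pos (by linarith) (by linarith)
  have glue : ∀ P : Euc n → Prop, (∀ i, ∀ᵐ x ∂(volume.restrict (bigC n i)), P x) → ∀ᵐ x, P x := by
    intro P h
    rw [← Measure.restrict_univ (μ := (volume : Measure (Euc n))), ← bigC_union n,
      ae_restrict_iUnion_iff]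
    exact h
  have hex : ∃ i, ∫⁻ x in bigC n i, ENNReal.ofReal (w x) ^ q ≠ 0 := by
    by_contra! hc
    refine hnz (glue _ fun i => ?_)
    have := (lintegral_eq_zero_iff (hw.ennreal_ofReal.pow_const _)).1 (hc i)
    filter_upwards [this] with x hx
    simpa [ENNReal.rpow_eq_zero_iff_of_pos hq] using hx
  obtain ⟨i, hi⟩ := hex
  refine glue _ fun j => ?_
  have hj : ∀ᵐ x ∂(volume.restrict (bigC n (max i j))), 0 < w x := by
    have hU : ∫⁻ x in bigC n (max i j), ENNReal.ofReal (w x) ^ q ≠ 0 := fun h =>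
      hi (le_antisymm (h ▸ lintegral_mono_set (bigC_mono n (le_max_left i j))) zero_le)
    have hS : ∫⁻ x in bigC n (max i j), ENNReal.ofReal (w x) ^ (-(dualExp p)) ≠ ∞ := by
      intro hS
      have hc := apq_cube hp hδ1 hpq' w (WithLp.toLp 2 fun _ => -(((max i j : ℕ) : ℝ) + 1))
        (2 * (((max i j : ℕ) : ℝ) + 1)) (by positivity)
      have hb := ne_top_of_le_ne_top (ENNReal.mul_ne_top hA
        (ENNReal.rpow_ne_top_of_nonneg (by linarith)
          (by rw [cube_vol]; exact ENNReal.pow_ne_top ENNReal.ofReal_ne_top))) hc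
      change (∫⁻ x in bigC n (max i j), ENNReal.ofReal (w x) ^ q) *
        (∫⁻ x in bigC n (max i j), ENNReal.ofReal (w x) ^ (-(dualExp p))) ^ (1 - δ) ≠ ∞ at hb
      rw [hS, ENNReal.top_rpow_of_pos (by linarith)] at hb
      exact hb (ENNReal.mul_top hU)
    filter_upwards [ae_lt_top (hw.ennreal_ofReal.pow_const _) hS] with x hx
    by_contra hneg
    rw [ENNReal.ofReal_of_nonpos (not_lt.1 hneg), ENNReal.zero_rpow_of_neg (by linarith)] at hx
    exact lt_irrefl _ hx
  exact ae_restrict_of_ae_restrict_of_subset (bigC_mono n (le_max_right i j)) hj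

/-- Linear growth estimate for the Riesz potential at the distinguished pair of
exponents `1/q₀ = 1/p₀ - α/n`, `q₀/p₀' = 1 - α/n` (Theorem 2.3). -/
theorem riesz_linear_growth
    (n : ℕ) (hn : 0 < n) (α : ℝ) (hα : 0 < α) (hαn : α < n)
    (p₀ q₀ : ℝ) (hp₀ : 1 < p₀)
    (hq₀ : 1 / q₀ = 1 / p₀ - α / n) (hpq₀ : q₀ / dualExp p₀ = 1 - α / n) :
    ∃ c : ℝ, 0 < c ∧ ∀ w f : Euc n → ℝ, Measurable w → (∀ x, 0 ≤ w x) → Measurable f →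
      Apq p₀ q₀ w < ⊤ →
      wLpE w (riesz α f) q₀ ≤ ENNReal.ofReal c * Apq p₀ q₀ w * wLp w f p₀ := by
  have hn0 : (0 : ℝ) < n := by exact_mod_cast hn
  have hδ1 : α / n < 1 := by rwa [div_lt_one hn0]
  have hd : 0 < dualExp p₀ := by unfold dualExp; exact div_pos (by linarith) (by linarith)
  have hq0 : 0 < q₀ := by
    have h1 : 0 < q₀ / dualExp p₀ := by rw [hpq₀]; linarith
    have := mul_pos h1 hd
    rwa [div_mul_cancel₀ _ hd.ne'] at this
  have hqq : q₀ * (q₀ - 1) = dualExp p₀ := by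
    have h1 : 1 / dualExp p₀ = 1 - 1 / p₀ := by
      unfold dualExp
      have : p₀ - 1 ≠ 0 := by linarith
      have : p₀ ≠ 0 := by linarith
      field_simp
    have h2 : q₀ / dualExp p₀ = 1 / q₀ + 1 / dualExp p₀ := by rw [hpq₀]; linarith
    field_simp at h2
    linarith
  have hq1 : 1 < q₀ := by
    by_contra h
    have : q₀ * (q₀ - 1) ≤ 0 := mul_nonpos_of_nonneg_of_nonpos hq0.le (by linarith)
    linarith
  set D : ℝ≥0∞ := ENNReal.ofReal (6 ^ ((n : ℝ) - α)) *
    ((Fintype.card (Fin n → Bool) : ℝ≥0∞) * bC (α / 2) p₀ q₀) with hD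
  have hDt : D ≠ ∞ := ENNReal.mul_ne_top ENNReal.ofReal_ne_top
    (ENNReal.mul_ne_top (ENNReal.natCast_ne_top _) (bC_ne_top (by linarith) hp₀ hq1))
  refine ⟨D.toReal + 1, by positivity, fun w f hw _ hf hA => ?_⟩
  by_cases hz : ∀ᵐ x, ENNReal.ofReal (w x) = 0
  · have : wLpE w (riesz α f) q₀ = 0 := by
      unfold wLpE
      have h0 : ∫⁻ x, (ENNReal.ofReal (w x) * riesz α f x) ^ q₀ = ∫⁻ _x : Euc n, 0 := by
        refine lintegral_congr_ae ?_
        filter_upwards [hz] with x hx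
        rw [hx, zero_mul, ENNReal.zero_rpow_of_pos hq0]
      rw [h0, lintegral_zero, ENNReal.zero_rpow_of_pos (by positivity)]
    rw [this]; exact zero_le
  · have hpos := pos_ae hp₀ hq0 hδ1 hpq₀ w hw hA.ne hz
    refine (core hn α hα hαn p₀ q₀ hp₀ hq1 hq₀ hpq₀ hqq w f hw hf hpos hA.ne).trans ?_
    have hDc : D ≤ ENNReal.ofReal (D.toReal + 1) := by
      rw [← ENNReal.ofReal_toReal hDt]
      refine ENNReal.ofReal_le_ofReal ?_
      rw [ENNReal.toReal_ofReal ENNReal.toReal_nonneg]; linarith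
    calc _ = D * Apq p₀ q₀ w * wLp w f p₀ := by rw [hD]; ring
      _ ≤ _ := by gcongr

end
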